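/- arXiv:2308.14567 — 3 statements merged into one kernel-verified Lean document; each statement's English description precedes it below -/
import Mathlib

section
/- Let k be a field, n ≥ 2 an integer, ζ ∈ k a primitive n-th root of unity, r an integer such that ζ^r is again a primitive n-th root of unity, and x ∈ k. Then the Jackson algebra 𝒥_x(r) is a Noetherian ring, a domain, and finitely generated as a module over its centre. -/
/-- The defining relations of the Jackson algebra `𝒥_x(r)` over `k`:
generators `e₀, e₁, e₂` and relations `e₀e₁ = ζ^r e₁e₀`, `e₂e₀ = ζ^r e₀e₂`,
`e₂e₁ = ζ^{2r} e₁e₂ + x e₀ + x (1 − ζ^{2r})`. -/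
inductive JacksonRel (k : Type*) [Field k] (ζ : k) (r : ℤ) (x : k) :
    FreeAlgebra k (Fin 3) → FreeAlgebra k (Fin 3) → Prop
  | r01 : JacksonRel k ζ r x (FreeAlgebra.ι k 0 * FreeAlgebra.ι k 1)
      (ζ ^ r • (FreeAlgebra.ι k 1 * FreeAlgebra.ι k 0))
  | r20 : JacksonRel k ζ r x (FreeAlgebra.ι k 2 * FreeAlgebra.ι k 0)
      (ζ ^ r • (FreeAlgebra.ι k 0 * FreeAlgebra.ι k 2))
  | r21 : JacksonRel k ζ r x (FreeAlgebra.ι k 2 * FreeAlgebra.ι k 1)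
      (ζ ^ (2 * r) • (FreeAlgebra.ι k 1 * FreeAlgebra.ι k 2) + x • FreeAlgebra.ι k 0 +
        (x * (1 - ζ ^ (2 * r))) • (1 : FreeAlgebra k (Fin 3)))

/-- The Jackson algebra `𝒥_x(r)` over `k`. -/
abbrev Jackson (k : Type*) [Field k] (ζ : k) (r : ℤ) (x : k) :=
  RingQuot (JacksonRel k ζ r x)

/-- The generators `e₀, e₁, e₂` of the Jackson algebra. -/
noncomputable def JacksonGen (k : Type*) [Field k] (ζ : k) (r : ℤ) (x : k) (i : Fin 3) :
    Jackson k ζ r x :=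
  RingQuot.mkAlgHom k (JacksonRel k ζ r x) (FreeAlgebra.ι k i)


namespace JacksonAux

section Alg
variable {k A : Type*} [Field k] [Ring A] [Algebra k A]

lemma mul_pow_of {y z : A} {s : k} (h : y * z = s • (z * y)) (b : ℕ) :
    y * z ^ b = s ^ b • (z ^ b * y) := by
  induction b with
  | zero => simp
  | succ b ih =>
    rw [pow_succ z, ← mul_assoc, ih, smul_mul_assoc, mul_assoc, h, mul_smul_comm, smul_smul,
      mul_assoc, pow_succ s]

lemma pow_mul_of {y z : A} {s : k} (h : y * z = s • (z * y)) (b : ℕ) :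
    y ^ b * z = s ^ b • (z * y ^ b) := by
  induction b with
  | zero => simp
  | succ b ih =>
    rw [pow_succ' y, mul_assoc, ih, mul_smul_comm, ← mul_assoc, h, smul_mul_assoc, smul_smul,
      mul_assoc, pow_succ s]

/-- The relations of the Jackson algebra, with `q = ζ ^ r`. -/
structure Rels (q x : k) (e0 e1 e2 : A) : Prop where
  hq : q ≠ 0
  h01 : e0 * e1 = q • (e1 * e0)
  h20 : e2 * e0 = q • (e0 * e2)
  h21 : e2 * e1 = q ^ 2 • (e1 * e2) + x • e0 + (x * (1 - q ^ 2)) • (1 : A)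
  hgen : Algebra.adjoin k {e0, e1, e2} = ⊤

variable {q x : k} {e0 e1 e2 : A}

lemma Rels.h10 (H : Rels q x e0 e1 e2) : e1 * e0 = q⁻¹ • (e0 * e1) := by
  rw [H.h01, smul_smul, inv_mul_cancel₀ H.hq, one_smul]

lemma Rels.e2_e1_pow (H : Rels q x e0 e1 e2) (a : ℕ) :
    e2 * e1 ^ (a + 1) = (q ^ 2) ^ (a + 1) • (e1 ^ (a + 1) * e2)
      + (x * ∑ i ∈ Finset.range (a + 1), q ^ i) • (e0 * e1 ^ a)
      + (x * (1 - (q ^ 2) ^ (a + 1))) • e1 ^ a := by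
  induction a with
  | zero => simp [H.h21]
  | succ a ih =>
    have h : e1 ^ (a + 1) * e0 = (q⁻¹) ^ (a + 1) • (e0 * e1 ^ (a + 1)) := pow_mul_of H.h10 _
    rw [pow_succ e1 (a + 1), ← mul_assoc, ih]
    simp only [add_mul, smul_mul_assoc]
    rw [mul_assoc (e1 ^ (a + 1)) e2 e1, H.h21]
    simp only [mul_add, mul_smul_comm, h, mul_one, smul_add, smul_smul]
    rw [mul_assoc e0, ← pow_succ e1, ← mul_assoc]
    have h1 : (q ^ 2) ^ (a + 1) * (x * q⁻¹ ^ (a + 1)) = x * q ^ (a + 1) := by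
      have := H.hq
      rw [inv_pow]; field_simp; ring
    rw [h1, Finset.sum_range_succ _ (a + 1)]
    module

lemma Rels.e2_pow_e1 (H : Rels q x e0 e1 e2) (a : ℕ) :
    e2 ^ (a + 1) * e1 = (q ^ 2) ^ (a + 1) • (e1 * e2 ^ (a + 1))
      + (x * (q ^ a * ∑ i ∈ Finset.range (a + 1), q ^ i)) • (e0 * e2 ^ a)
      + (x * (1 - (q ^ 2) ^ (a + 1))) • e2 ^ a := by
  induction a with
  | zero => simp [H.h21]
  | succ a ih =>
    rw [pow_succ' e2 (a + 1), mul_assoc, ih]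
    simp only [mul_add, mul_smul_comm]
    rw [← mul_assoc e2 e1, ← mul_assoc e2 e0, H.h21, H.h20, ← pow_succ']
    simp only [add_mul, smul_mul_assoc, one_mul, smul_add, smul_smul]
    rw [mul_assoc e0, ← pow_succ' e2, mul_assoc e1, ← pow_succ' e2,
      Finset.sum_range_succ _ (a + 1)]
    module

/-- PBW monomials. -/
def mon (e0 e1 e2 : A) (p : ℕ × ℕ × ℕ) : A := e0 ^ p.1 * e1 ^ p.2.1 * e2 ^ p.2.2

lemma Rels.span (H : Rels q x e0 e1 e2) :
    Submodule.span k (Set.range (mon e0 e1 e2)) = ⊤ := by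
  set S := Submodule.span k (Set.range (mon e0 e1 e2)) with hS
  have hm : ∀ b a c, e0 ^ b * e1 ^ a * e2 ^ c ∈ S := fun b a c =>
    Submodule.subset_span ⟨(b, a, c), rfl⟩
  have red : ∀ y : A, (∀ b a c, y * (e0 ^ b * e1 ^ a * e2 ^ c) ∈ S) → ∀ s ∈ S, y * s ∈ S := by
    intro y hy s hs
    induction hs using Submodule.span_induction with
    | mem s hs => obtain ⟨⟨b, a, c⟩, rfl⟩ := hs; exact hy b a c
    | zero => simp
    | add u v _ _ hu hv => rw [mul_add]; exact S.add_mem hu hv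
    | smul t u _ hu => rw [mul_smul_comm]; exact S.smul_mem _ hu
  have key : ∀ y : A, ∀ s ∈ S, y * s ∈ S := by
    intro y
    have hy : y ∈ Algebra.adjoin k {e0, e1, e2} := by rw [H.hgen]; trivial
    induction hy using Algebra.adjoin_induction with
    | mem y hy =>
      apply red
      intro b a c
      rcases hy with rfl | rfl | rfl
      · rw [← mul_assoc, ← mul_assoc, ← pow_succ']; exact hm _ _ _
      · rw [← mul_assoc, ← mul_assoc, mul_pow_of H.h10, smul_mul_assoc, smul_mul_assoc,
          mul_assoc (e0 ^ b), ← pow_succ']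
        exact S.smul_mem _ (hm _ _ _)
      · rw [← mul_assoc, ← mul_assoc, mul_pow_of H.h20, smul_mul_assoc, smul_mul_assoc]
        apply S.smul_mem
        cases a with
        | zero =>
          rw [pow_zero, mul_one, mul_assoc, ← pow_succ']
          simpa using hm b 0 (c + 1)
        | succ a =>
          rw [mul_assoc (e0 ^ b), H.e2_e1_pow]
          simp only [mul_add, add_mul, mul_smul_comm, smul_mul_assoc]
          refine S.add_mem (S.add_mem (S.smul_mem _ ?_) (S.smul_mem _ ?_)) (S.smul_mem _ ?_)
          · rw [← mul_assoc, mul_assoc, ← pow_succ']; exact hm _ _ _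
          · rw [← mul_assoc, ← pow_succ]; exact hm _ _ _
          · exact hm _ _ _
    | algebraMap t =>
      intro s hs
      rw [← Algebra.smul_def]; exact S.smul_mem _ hs
    | add u v _ _ hu hv => intro s hs; rw [add_mul]; exact S.add_mem (hu s hs) (hv s hs)
    | mul u v _ _ hu hv => intro s hs; rw [mul_assoc]; exact hu _ (hv s hs)
  rw [eq_top_iff]
  intro y _
  have := key y 1 (by simpa using hm 0 0 0)
  simpa using this

lemma Rels.mem_center (H : Rels q x e0 e1 e2) {z : A} (h0 : e0 * z = z * e0) (h1 : e1 * z = z * e1)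
    (h2 : e2 * z = z * e2) : z ∈ Subalgebra.center k A := by
  rw [Subalgebra.mem_center_iff]
  intro y
  have hy : y ∈ Algebra.adjoin k {e0, e1, e2} := by rw [H.hgen]; trivial
  induction hy using Algebra.adjoin_induction with
  | mem y hy => rcases hy with rfl | rfl | rfl <;> assumption
  | algebraMap t => exact Algebra.commutes t z
  | add u v _ _ hu hv => rw [add_mul, mul_add, hu, hv]
  | mul u v _ _ hu hv => rw [mul_assoc, hv, ← mul_assoc, hu, mul_assoc]

variable {n : ℕ}

lemma Rels.central (H : Rels q x e0 e1 e2) (hn : 2 ≤ n) (hr : IsPrimitiveRoot q n) :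
    e0 ^ n ∈ Subalgebra.center k A ∧ e1 ^ n ∈ Subalgebra.center k A ∧
      e2 ^ n ∈ Subalgebra.center k A := by
  have hq : q ^ n = 1 := hr.pow_eq_one
  have hq2 : (q ^ 2) ^ n = 1 := by rw [← pow_mul, mul_comm, pow_mul, hq, one_pow]
  have hqi : q⁻¹ ^ n = 1 := by rw [inv_pow, hq, inv_one]
  have hsum : ∑ i ∈ Finset.range n, q ^ i = 0 := hr.geom_sum_eq_zero hn
  obtain ⟨m, rfl⟩ : ∃ m, n = m + 1 := ⟨n - 1, by omega⟩
  refine ⟨H.mem_center ?_ ?_ ?_, H.mem_center ?_ ?_ ?_, H.mem_center ?_ ?_ ?_⟩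
  · rw [← pow_succ, ← pow_succ']
  · rw [mul_pow_of H.h10, hqi, one_smul]
  · rw [mul_pow_of H.h20, hq, one_smul]
  · rw [mul_pow_of H.h01, hq, one_smul]
  · rw [← pow_succ, ← pow_succ']
  · rw [H.e2_e1_pow, hq2, hsum]; simp
  · rw [pow_mul_of H.h20, hq, one_smul]
  · rw [H.e2_pow_e1, hq2, hsum]; simp
  · rw [← pow_succ, ← pow_succ']

lemma Rels.finite (H : Rels q x e0 e1 e2) (hn : 2 ≤ n) (hr : IsPrimitiveRoot q n) :
    IsNoetherianRing A ∧ Module.Finite (Subalgebra.center k A) A := by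
  obtain ⟨c0, c1, c2⟩ := H.central hn hr
  set Z := Subalgebra.center k A
  let z0 : Z := ⟨_, c0⟩
  let z1 : Z := ⟨_, c1⟩
  let z2 : Z := ⟨_, c2⟩
  let S : Subalgebra k Z := Algebra.adjoin k {z0, z1, z2}
  have hz0 : z0 ∈ S := Algebra.subset_adjoin (by simp)
  have hz1 : z1 ∈ S := Algebra.subset_adjoin (by simp)
  have hz2 : z2 ∈ S := Algebra.subset_adjoin (by simp)
  have hS : IsNoetherianRing S := by
    exact isNoetherianRing_of_fg (Subalgebra.fg_def.2 ⟨{z0, z1, z2}, Set.toFinite _, rfl⟩)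
  have hfin : Module.Finite S A := by
    let g : Fin n × Fin n × Fin n → A := fun p => mon e0 e1 e2 (p.1, p.2.1, p.2.2)
    refine ⟨⟨(Set.finite_range g).toFinset, ?_⟩⟩
    rw [Set.Finite.coe_toFinset, eq_top_iff]
    intro y _
    have hy : y ∈ Submodule.span k (Set.range (mon e0 e1 e2)) := by rw [H.span]; trivial
    induction hy using Submodule.span_induction with
    | mem s hs =>
      obtain ⟨⟨b, a, c⟩, rfl⟩ := hs
      let s : S := ⟨z0, hz0⟩ ^ (b / n) * ⟨z1, hz1⟩ ^ (a / n) * ⟨z2, hz2⟩ ^ (c / n)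
      have hn0 : 0 < n := by omega
      have : mon e0 e1 e2 (b, a, c) = s • g (⟨b % n, Nat.mod_lt _ hn0⟩, ⟨a % n, Nat.mod_lt _ hn0⟩,
          ⟨c % n, Nat.mod_lt _ hn0⟩) := by
        have e : ∀ (t : S) (y : A), t • y = ((t : Z) : A) * y := fun _ _ => rfl
        rw [e]
        have hA := Subalgebra.mem_center_iff.1 (pow_mem c1 (a / n))
        have hB := Subalgebra.mem_center_iff.1 (pow_mem c2 (c / n))
        simp only [s, g, mon, z0, z1, z2, Subalgebra.coe_mul, Subalgebra.coe_pow]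
        conv_lhs => rw [← Nat.div_add_mod b n, ← Nat.div_add_mod a n, ← Nat.div_add_mod c n]
        simp only [pow_add, pow_mul]
        generalize (e0 ^ n) ^ (b / n) = u0 at *
        generalize (e1 ^ n) ^ (a / n) = u1 at *
        generalize (e2 ^ n) ^ (c / n) = u2 at *
        calc _ = u0 * (e0 ^ (b % n) * u1) * (e1 ^ (a % n) * u2) * e2 ^ (c % n) := by
              simp only [mul_assoc]
          _ = u0 * u1 * ((e0 ^ (b % n) * e1 ^ (a % n)) * u2) * e2 ^ (c % n) := by
              rw [hA]; simp only [mul_assoc]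
          _ = _ := by rw [hB]; simp only [mul_assoc]
      rw [this]
      exact Submodule.smul_mem _ _ (Submodule.subset_span ⟨_, rfl⟩)
    | zero => simp
    | add u v _ _ hu hv => exact Submodule.add_mem _ (hu trivial) (hv trivial)
    | smul t u _ hu =>
      have : t • u = (algebraMap k S t) • u := by rw [algebraMap_smul]
      rw [this]
      exact Submodule.smul_mem _ _ (hu trivial)
  refine ⟨?_, Module.Finite.of_restrictScalars_finite S Z A⟩
  have : IsNoetherian S A := isNoetherian_of_isNoetherianRing_of_finite S A
  exact isNoetherian_of_tower S this

end Alg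

section Skew
open SkewMonoidAlgebra

lemma skew_noZeroDivisors {R G : Type*} [Ring R] [NoZeroDivisors R] [Group G] [UniqueProds G]
    [MulSemiringAction G R] : NoZeroDivisors (SkewMonoidAlgebra R G) where
  eq_zero_or_eq_zero_of_mul_eq_zero {f g} hfg := by
    classical
    contrapose! hfg
    have hf : f.support.Nonempty := by
      rw [Finset.nonempty_iff_ne_empty, ne_eq, support_eq_empty]; exact hfg.1
    have hg : g.support.Nonempty := by
      rw [Finset.nonempty_iff_ne_empty, ne_eq, support_eq_empty]; exact hfg.2
    obtain ⟨a, ha, b, hb, h⟩ := UniqueProds.uniqueMul_of_nonempty hf hg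
    intro h0
    have h1 : (f * g).coeff (a * b) = f.coeff a * a • g.coeff b := by
      rw [coeff_mul, sum_def', Finset.sum_eq_single a, sum_def', Finset.sum_eq_single b]
      · simp
      · intro b' hb' hne
        rw [if_neg]
        intro he
        exact hne (h ha hb' he).2
      · intro hb'; exact absurd hb hb'
      · intro a' ha' hne
        rw [sum_def']
        apply Finset.sum_eq_zero
        intro b' hb'
        rw [if_neg]
        intro he
        exact hne (h ha' hb' he).1
      · intro ha'; exact absurd ha ha'
    rw [h0] at h1
    rw [mem_support_iff] at ha hb
    have h2 : a • g.coeff b ≠ 0 := fun hh => hb (by simpa using congrArg (a⁻¹ • ·) hh)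
    exact mul_ne_zero ha h2 h1.symm

end Skew

section Sigma
open Polynomial

variable {k : Type*} [Field k]

/-- `X ↦ q X`, `Y ↦ q² Y`. -/
noncomputable def sigHom (q : k) : k[X][X] →ₐ[k] k[X][X] :=
  aevalAeval (C (C q * X)) (C (C (q ^ 2)) * X)

lemma sigHom_X (q : k) : sigHom q (C X) = C (C q * X) := by simp [sigHom]
lemma sigHom_Y (q : k) : sigHom q X = C (C (q ^ 2)) * X := by simp [sigHom]
lemma sigHom_CC (q s : k) : sigHom q (C (C s)) = C (C s) := (sigHom q).commutes s

lemma sigHom_comp {q s : k} (h : q * s = 1) : (sigHom q).comp (sigHom s) = AlgHom.id k _ := by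
  have h2 : s ^ 2 * q ^ 2 = 1 := by rw [← mul_pow, mul_comm, h, one_pow]
  have h' : s * q = 1 := by rw [mul_comm, h]
  ext1
  · ext1
    change sigHom q (sigHom s (C X)) = C X
    rw [sigHom_X, C_mul, map_mul, sigHom_CC, sigHom_X, ← C_mul, ← mul_assoc, ← C_mul, h', C_1,
      one_mul]
  · change sigHom q (sigHom s X) = X
    rw [sigHom_Y, map_mul, sigHom_CC, sigHom_Y, ← mul_assoc, ← C_mul, ← C_mul, h2, C_1, C_1,
      one_mul]

lemma sigHom_C (q : k) (a : k[X]) : sigHom q (C a) = C (a.comp (C q * X)) := by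
  have : (sigHom q).comp CAlgHom = CAlgHom.comp (aeval (C q * X : k[X])) := by
    ext1
    change sigHom q (C X) = C (aeval (C q * X : k[X]) X)
    rw [sigHom_X, aeval_X]
  have h := DFunLike.congr_fun this a
  exact h

lemma sigHom_coeff (q : k) (p : k[X][X]) (j : ℕ) :
    (sigHom q p).coeff j = C ((q ^ 2) ^ j) * (p.coeff j).comp (C q * X) := by
  induction p using Polynomial.induction_on' with
  | add p r hp hr => simp only [map_add, coeff_add, hp, hr, add_comp, mul_add]
  | monomial m a =>
    rw [← C_mul_X_pow_eq_monomial, map_mul, map_pow, sigHom_Y, sigHom_C, mul_pow, ← C_pow, ← C_pow,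
      coeff_C_mul, coeff_C_mul, coeff_C_mul, coeff_X_pow]
    split_ifs with h
    · subst h; rw [mul_one, mul_one, mul_comm]
    · rw [mul_zero, mul_zero, mul_zero, zero_comp, mul_zero]

/-- Degree `c` in `Y` with nonzero constant leading coefficient. -/
def Lead (c : ℕ) (p : k[X][X]) : Prop := (∀ j, c < j → p.coeff j = 0) ∧ ∃ s : k, s ≠ 0 ∧ p.coeff c = C s

lemma Lead.sig {c : ℕ} {p : k[X][X]} (h : Lead c p) {q : k} (hq : q ≠ 0) :
    Lead c (sigHom q p) := by
  obtain ⟨h1, s, hs, h2⟩ := h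
  refine ⟨fun j hj => by rw [sigHom_coeff, h1 j hj]; simp, (q ^ 2) ^ c * s, ?_, ?_⟩
  · exact mul_ne_zero (pow_ne_zero _ (pow_ne_zero _ hq)) hs
  · rw [sigHom_coeff, h2, C_comp, C_mul]

lemma Lead.mul {c : ℕ} {p : k[X][X]} (h : Lead c p) (g : k[X]) : Lead (c + 1) ((X + C g) * p) := by
  obtain ⟨h1, s, hs, h2⟩ := h
  refine ⟨fun j hj => ?_, s, hs, ?_⟩
  · obtain ⟨i, rfl⟩ : ∃ i, j = i + 1 := ⟨j - 1, by omega⟩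
    rw [add_mul, coeff_add, coeff_X_mul, coeff_C_mul, h1 i (by omega), h1 (i + 1) (by omega)]
    simp
  · rw [add_mul, coeff_add, coeff_X_mul, coeff_C_mul, h2, h1 (c + 1) (by omega)]
    simp

end Sigma

section Dom
open Polynomial SkewMonoidAlgebra

variable {k A : Type*} [Field k] [Ring A] [Algebra k A] {q x : k} {e0 e1 e2 : A}

/-- The element `w`. -/
noncomputable def ww (q x : k) : k[X][X] := X + C (C (x / (1 - q)) * X + C x)

lemma ww_eq {q : k} (x : k) (hq : q ≠ 0) (hq1 : q ≠ 1) :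
    ww q x = q ^ 2 • sigHom q⁻¹ (ww q x) + x • (C X) + (x * (1 - q ^ 2)) • 1 := by
  have h1 : 1 - q ≠ 0 := sub_ne_zero.2 hq1.symm
  have e : ∀ (s : k) (p : k[X][X]), s • p = C (C s) * p := fun s p => by
    rw [Algebra.smul_def]; rfl
  simp only [ww, map_add, sigHom_Y, sigHom_C, e]
  simp only [map_add, map_mul, add_comp, mul_comp, C_comp, X_comp]
  have a1 : q ^ 2 * (q⁻¹) ^ 2 = 1 := by field_simp
  have a2 : q ^ 2 * (x / (1 - q)) * q⁻¹ + x = x / (1 - q) := by field_simp; ring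
  have a3 : q ^ 2 * x + x * (1 - q ^ 2) = x := by ring
  have b1 : (C (C (q ^ 2)) * C (C (q⁻¹ ^ 2)) : k[X][X]) = 1 := by
    rw [← C_mul, ← C_mul, a1, C_1, C_1]
  have b2 := congrArg (fun t => (C (C t) : k[X][X])) a2
  have b3 := congrArg (fun t => (C (C t) : k[X][X])) a3
  simp only [map_add, map_mul] at b2 b3
  linear_combination (-X) * b1 - C X * b2 - b3

/-- If `A` maps to the skew Laurent ring in the right way, it is a domain. -/
lemma isDomain_of_hom (H : Rels q x e0 e1 e2)
    [MulSemiringAction (Multiplicative ℤ) k[X][X]] [SMulCommClass (Multiplicative ℤ) k k[X][X]]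
    (h1 : ∀ p : k[X][X], (Multiplicative.ofAdd (1 : ℤ)) • p = sigHom q⁻¹ p)
    (h2 : ∀ p : k[X][X], (Multiplicative.ofAdd (-1 : ℤ)) • p = sigHom q p)
    (φ : A →ₐ[k] SkewMonoidAlgebra k[X][X] (Multiplicative ℤ))
    (f0 : φ e0 = single 1 (C X)) (f1 : φ e1 = single (Multiplicative.ofAdd (1 : ℤ)) 1)
    (f2 : φ e2 = single (Multiplicative.ofAdd (-1 : ℤ)) (ww q x)) : IsDomain A := by
  have hq := H.hq
  have p2 : ∀ c : ℕ, ∃ P, Lead c P ∧ φ e2 ^ c = single (Multiplicative.ofAdd (-(c : ℤ))) P := by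
    intro c
    induction c with
    | zero => exact ⟨1, ⟨fun j hj => by rw [Polynomial.coeff_one, if_neg (by omega)], 1, one_ne_zero,
        by simp⟩, by simp⟩
    | succ c ih =>
      obtain ⟨P, hP, hc⟩ := ih
      refine ⟨_, (hP.sig hq).mul (C (x / (1 - q)) * X + C x), ?_⟩
      rw [pow_succ', hc, f2, single_mul_single, h2, ← ofAdd_add, ww]
      congr 2
      push_cast; ring
  have p1 : ∀ a c : ℕ, ∃ P, Lead c P ∧
      φ e1 ^ a * φ e2 ^ c = single (Multiplicative.ofAdd ((a : ℤ) - c)) P := by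
    intro a c
    induction a with
    | zero => obtain ⟨P, hP, hc⟩ := p2 c; exact ⟨P, hP, by simp [hc]⟩
    | succ a ih =>
      obtain ⟨P, hP, hc⟩ := ih
      refine ⟨_, hP.sig (inv_ne_zero hq), ?_⟩
      rw [pow_succ', mul_assoc, hc, f1, single_mul_single, h1, ← ofAdd_add, one_mul]
      congr 2
      push_cast; ring
  have p0 : ∀ b a c : ℕ, ∃ P, Lead c P ∧
      φ (mon e0 e1 e2 (b, a, c)) = single (Multiplicative.ofAdd ((a : ℤ) - c)) (C (X ^ b) * P) := by
    intro b a c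
    obtain ⟨P, hP, hc⟩ := p1 a c
    refine ⟨P, hP, ?_⟩
    rw [mon, map_mul, map_mul, map_pow, map_pow, map_pow, mul_assoc, hc, f0]
    clear hc
    induction b with
    | zero => simp
    | succ b ih =>
      rw [pow_succ', mul_assoc, ih, single_mul_single, one_mul, one_smul, pow_succ', C_mul,
        mul_assoc]
  have hinj : Function.Injective φ := by
    classical
    rw [injective_iff_map_eq_zero]
    intro y hy
    have hy' : y ∈ Submodule.span k (Set.range (mon e0 e1 e2)) := by rw [H.span]; trivial
    obtain ⟨f, rfl⟩ := (Finsupp.mem_span_range_iff_exists_finsupp).1 hy'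
    suffices hf0 : f = 0 by rw [hf0, Finsupp.sum_zero_index]
    have hf : ∑ p ∈ f.support, f p • φ (mon e0 e1 e2 p) = 0 := by
      rw [← hy, Finsupp.sum, _root_.map_sum]
      exact Finset.sum_congr rfl fun p _ => (map_smul φ (f p) _).symm
    clear hy hy'
    by_contra hne
    obtain ⟨⟨b, a, c⟩, hmem, hmax⟩ := Finset.exists_max_image f.support (fun p => p.2.2)
      (Finsupp.support_nonempty_iff.2 hne)
    let T : SkewMonoidAlgebra k[X][X] (Multiplicative ℤ) →+ k :=
      { toFun := fun F => ((F.coeff (Multiplicative.ofAdd ((a : ℤ) - c))).coeff c).coeff b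
        map_zero' := by simp
        map_add' := by intros; simp }
    have hT : ∀ (s : k) F, T (s • F) = s * T F := by
      intro s F
      change (((s • F).coeff _).coeff c).coeff b = _
      rw [SkewMonoidAlgebra.coeff_smul]
      simp [T]
    have h0 := congrArg T hf
    rw [_root_.map_sum, map_zero, Finset.sum_eq_single (b, a, c), hT] at h0
    · obtain ⟨P, ⟨-, s, hs, hP⟩, hPe⟩ := p0 b a c
      rw [hPe] at h0
      rcases mul_eq_zero.1 h0 with h | h
      · exact (Finsupp.mem_support_iff.1 hmem) h
      · apply hs
        change (((single _ _ : SkewMonoidAlgebra k[X][X] (Multiplicative ℤ)).coeff _).coeff c).coeff b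
          = 0 at h
        rwa [coeff_single_apply, if_pos rfl, coeff_C_mul, hP, coeff_mul_C, coeff_X_pow, if_pos rfl,
          one_mul] at h
    · rintro ⟨b', a', c'⟩ hm hneq
      have hle := hmax _ hm
      simp only at hle
      obtain ⟨P, ⟨hP1, s, hs, hP⟩, hPe⟩ := p0 b' a' c'
      rw [hT, hPe]
      apply mul_eq_zero_of_right
      change (((single _ _ : SkewMonoidAlgebra k[X][X] (Multiplicative ℤ)).coeff _).coeff c).coeff b
        = 0
      rw [coeff_single_apply]
      split_ifs with hac
      · have hac' : (a' : ℤ) - c' = a - c := Multiplicative.ofAdd.injective hac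
        rw [coeff_C_mul]
        rcases hle.lt_or_eq with hlt | rfl
        · rw [hP1 _ hlt]; simp
        · have : a' = a := by omega
          subst this
          rw [hP, coeff_mul_C, coeff_X_pow, if_neg, zero_mul]
          rintro rfl
          exact hneq rfl
      · simp
    · intro h; exact absurd hmem h
  have : NoZeroDivisors (SkewMonoidAlgebra k[X][X] (Multiplicative ℤ)) := skew_noZeroDivisors
  have : NoZeroDivisors A := hinj.noZeroDivisors φ (map_zero φ) (map_mul φ)
  have : Nontrivial A := φ.toRingHom.domain_nontrivial
  exact NoZeroDivisors.to_isDomain A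

end Dom

end JacksonAux

open Polynomial SkewMonoidAlgebra JacksonAux in
/-- Let `k` be a field, `n ≥ 2`, `ζ ∈ k` a primitive `n`-th root of
unity, `r` an integer such that `ζ^r` is again a primitive `n`-th root of unity, and
`x ∈ k`.  Then the Jackson algebra `𝒥_x(r)` is a Noetherian ring, a domain, and
finitely generated as a module over its centre. -/
theorem jackson_noetherian_domain_finite_over_centre (k : Type*) [Field k]
    (n : ℕ) (hn : 2 ≤ n) (ζ : k) (hζ : IsPrimitiveRoot ζ n)
    (r : ℤ) (hr : IsPrimitiveRoot (ζ ^ r) n) (x : k) :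
    IsNoetherianRing (Jackson k ζ r x) ∧
    IsDomain (Jackson k ζ r x) ∧
    Module.Finite (Subalgebra.center k (Jackson k ζ r x)) (Jackson k ζ r x) := by
  have hq0 : ζ ^ r ≠ 0 := hr.ne_zero (by omega)
  have hq1 : ζ ^ r ≠ 1 := hr.ne_one (by omega)
  have hsq : ζ ^ (2 * r) = (ζ ^ r) ^ 2 := by rw [mul_comm, zpow_mul]; norm_cast
  have H : Rels (ζ ^ r) x (JacksonGen k ζ r x 0) (JacksonGen k ζ r x 1) (JacksonGen k ζ r x 2) := by
    refine ⟨hq0, ?_, ?_, ?_, ?_⟩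
    · have := RingQuot.mkAlgHom_rel k (JacksonRel.r01 (k := k) (ζ := ζ) (r := r) (x := x))
      simp only [map_mul, map_smul, map_add, map_one] at this
      exact this
    · have := RingQuot.mkAlgHom_rel k (JacksonRel.r20 (k := k) (ζ := ζ) (r := r) (x := x))
      simp only [map_mul, map_smul, map_add, map_one] at this
      exact this
    · have := RingQuot.mkAlgHom_rel k (JacksonRel.r21 (k := k) (ζ := ζ) (r := r) (x := x))
      rw [← hsq]
      simp only [map_mul, map_smul, map_add, map_one] at this
      exact this
    · have h1 := congrArg (Subalgebra.map (RingQuot.mkAlgHom k (JacksonRel k ζ r x)))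
        (FreeAlgebra.adjoin_range_ι k (Fin 3))
      rw [AlgHom.map_adjoin, Algebra.map_top,
        (AlgHom.range_eq_top _).2 (RingQuot.mkAlgHom_surjective k _)] at h1
      rw [← h1, ← Set.range_comp]
      congr 1
      ext y
      simp only [Set.mem_range, Fin.exists_fin_succ, Set.mem_insert_iff, Set.mem_singleton_iff,
        JacksonGen, Function.comp]
      simp [eq_comm]
  obtain ⟨hN, hF⟩ := H.finite hn hr
  refine ⟨hN, ?_, hF⟩
  set q := ζ ^ r with hqdef
  let σ : k[X][X] ≃ₐ[k] k[X][X] := AlgEquiv.ofAlgHom (sigHom q⁻¹) (sigHom q)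
    (sigHom_comp (inv_mul_cancel₀ hq0)) (sigHom_comp (mul_inv_cancel₀ hq0))
  letI : MulSemiringAction (Multiplicative ℤ) k[X][X] :=
    MulSemiringAction.compHom _ (zpowersHom (k[X][X] ≃ₐ[k] k[X][X]) σ)
  have hact : ∀ (g : Multiplicative ℤ) (p : k[X][X]), g • p = (σ ^ g.toAdd) p := fun _ _ => rfl
  haveI : SMulCommClass (Multiplicative ℤ) k k[X][X] :=
    ⟨fun g s p => by rw [hact, hact, map_smul]⟩
  have h1 : ∀ p : k[X][X], (Multiplicative.ofAdd (1 : ℤ)) • p = sigHom q⁻¹ p := fun p => by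
    rw [hact, toAdd_ofAdd, zpow_one]; rfl
  have h2 : ∀ p : k[X][X], (Multiplicative.ofAdd (-1 : ℤ)) • p = sigHom q p := fun p => by
    rw [hact, toAdd_ofAdd, zpow_neg_one]; rfl
  let v : Fin 3 → SkewMonoidAlgebra k[X][X] (Multiplicative ℤ) :=
    ![single 1 (C X), single (Multiplicative.ofAdd (1 : ℤ)) 1,
      single (Multiplicative.ofAdd (-1 : ℤ)) (ww q x)]
  have e : ∀ (s : k) (p : k[X][X]), s • p = C (C s) * p := fun s p => by
    rw [Algebra.smul_def]; rfl
  let φ : Jackson k ζ r x →ₐ[k] SkewMonoidAlgebra k[X][X] (Multiplicative ℤ) :=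
    RingQuot.liftAlgHom k ⟨FreeAlgebra.lift k v, by
      intro a b hab
      cases hab with
      | r01 =>
        simp only [map_mul, map_smul, FreeAlgebra.lift_ι_apply]
        simp only [v, Matrix.cons_val, single_mul_single, h1, one_smul, sigHom_X, one_mul, mul_one,
          SkewMonoidAlgebra.smul_single]
        congr 1
        rw [← hqdef, e, ← C_mul, ← mul_assoc, ← C_mul, mul_inv_cancel₀ hq0, C_1, one_mul]
      | r20 =>
        simp only [map_mul, map_smul, FreeAlgebra.lift_ι_apply]
        simp only [v, Matrix.cons_val, single_mul_single, h2, one_smul, sigHom_X, one_mul, mul_one,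
          SkewMonoidAlgebra.smul_single]
        congr 1
        rw [← hqdef, e, C_mul]
        ring
      | r21 =>
        simp only [map_mul, map_smul, map_add, map_one, FreeAlgebra.lift_ι_apply]
        simp only [v, Matrix.cons_val, single_mul_single, h1, h2, one_mul, map_one, mul_one,
          SkewMonoidAlgebra.smul_single, SkewMonoidAlgebra.one_def, ← ofAdd_add, hsq]
        rw [show (-1 : ℤ) + 1 = 0 by ring, show (1 : ℤ) + -1 = 0 by ring, ofAdd_zero,
          ← single_add, ← single_add]
        congr 1
        exact ww_eq x hq0 hq1⟩
  have hφ : ∀ i, φ (JacksonGen k ζ r x i) = v i := fun i => by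
    simp [φ, JacksonGen]
  exact isDomain_of_hom H h1 h2 φ (hφ 0) (hφ 1) (hφ 2)
end

section
/- Let k be a field, n ≥ 2 an integer, ζ ∈ k a primitive n-th root of unity, r an integer such that ζ^r is again a primitive n-th root of unity, and x ∈ k. Then the centre Z(𝒥_x(r)) of the Jackson algebra 𝒥_x(r) is an integrally closed (normal) commutative domain whose Krull dimension equals 3. -/
section JacksonHelpers

open LaurentPolynomial

/-- Twisted scaling of Laurent polynomials: apply `f` to coefficients and send `T` to `u * T`. -/
noncomputable def jkScale {R S : Type*} [CommRing R] [CommRing S] (f : R →+* S) (u : Sˣ) :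
    LaurentPolynomial R →+* LaurentPolynomial S :=
  LaurentPolynomial.eval₂ (LaurentPolynomial.C.comp f)
    (Units.map (LaurentPolynomial.C (R := S)).toMonoidHom u * (isUnit_T (R := S) 1).unit)


lemma jkScale_C_mul_T {R S : Type*} [CommRing R] [CommRing S] (f : R →+* S) (u : Sˣ)
    (a : R) (i : ℤ) : jkScale f u (C a * T i) = C (f a * ((u ^ i : Sˣ) : S)) * T i := by
  have h : ∀ i : ℤ, (((isUnit_T (R := S) 1).unit ^ i : (LaurentPolynomial S)ˣ) :
      LaurentPolynomial S) = T i := by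
    intro i
    have h1 : ((isUnit_T (R := S) 1).unit : (LaurentPolynomial S)ˣ) = 
      ⟨T 1, T (-1), by rw [← T_add]; simp, by rw [← T_add]; simp⟩ := by
      ext1; rfl
    rw [h1]
    induction i using Int.induction_on with
    | zero => simp
    | succ i ih => rw [zpow_add_one, Units.val_mul, ih, ← T_add]
    | pred i ih => rw [zpow_sub_one, Units.val_mul, ih, Units.inv_mk, ← T_add, sub_eq_add_neg]
  rw [jkScale, eval₂_C_mul_T, mul_zpow, Units.val_mul, h, ← map_zpow, map_mul, mul_assoc]
  rfl

lemma jkScale_coeff {R S : Type*} [CommRing R] [CommRing S] (f : R →+* S) (u : Sˣ)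
    (g : LaurentPolynomial R) (i : ℤ) :
    (jkScale f u g).coeff i = f (g.coeff i) * ((u ^ i : Sˣ) : S) := by
  induction g using LaurentPolynomial.induction_on' with
  | add p q hp hq => simp [hp, hq, add_mul]
  | C_mul_T n a =>
    rw [jkScale_C_mul_T, ← single_eq_C_mul_T, ← single_eq_C_mul_T]
    by_cases h : n = i
    · subst h; simp only [AddMonoidAlgebra.coeff_single, Finsupp.single_eq_same]
    · simp only [AddMonoidAlgebra.coeff_single, Finsupp.single_apply, h, if_false, map_zero,
        zero_mul]

lemma jk_laurent_sum {R : Type*} [CommRing R] (g : LaurentPolynomial R) :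
    g = ∑ i ∈ g.coeff.support, C (g.coeff i) * T i := by
  conv_lhs => rw [← AddMonoidAlgebra.sum_coeff_single g]
  simp [Finsupp.sum, single_eq_C_mul_T]

lemma jk_coeff_C_mul {R : Type*} [CommRing R] (d : R) (g : LaurentPolynomial R) (i : ℤ) :
    (C d * g).coeff i = d * g.coeff i := by
  rw [← smul_eq_C_mul]; simp

lemma jk_coeff_T_mul {R : Type*} [CommRing R] (j : ℤ) (g : LaurentPolynomial R) (i : ℤ) :
    (T j * g).coeff i = g.coeff (i - j) := by
  induction g using LaurentPolynomial.induction_on' with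
  | add p q hp hq => rw [mul_add, AddMonoidAlgebra.coeff_add, Finsupp.add_apply, hp, hq]; simp
  | C_mul_T n a =>
    rw [mul_left_comm, ← T_add, ← single_eq_C_mul_T, ← single_eq_C_mul_T]
    simp only [AddMonoidAlgebra.coeff_single, Finsupp.single_apply]
    congr 1
    simp; omega

lemma jk_laurent_closed {R : Type*} [CommRing R] [IsDomain R] [UniqueFactorizationMonoid R] :
    IsIntegrallyClosed (LaurentPolynomial R) :=
  isIntegrallyClosed_of_isLocalization (R := Polynomial R) (LaurentPolynomial R)
    (Submonoid.powers (Polynomial.X : Polynomial R))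
    (powers_le_nonZeroDivisors_of_noZeroDivisors Polynomial.X_ne_zero)

/-- Krull dimension is preserved by injective integral ring extensions. -/
lemma jk_krullDim_integral {R S : Type*} [CommRing R] [CommRing S] (f : R →+* S)
    (hf : Function.Injective f) (hi : f.IsIntegral) : ringKrullDim S = ringKrullDim R := by
  let := f.toAlgebra
  have : Algebra.IsIntegral R S := ⟨hi⟩
  apply le_antisymm
  · refine Order.krullDim_le_of_strictMono (PrimeSpectrum.comap (algebraMap R S)) ?_
    intro p q hpq
    exact Ideal.IsIntegral.comap_lt_comap (R := R) (I := p.asIdeal) (J := q.asIdeal) hpq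
  · refine iSup_le fun l => ?_
    obtain ⟨Q, -, hQ, hQ'⟩ := Ideal.exists_ideal_over_prime_of_isIntegral (S := S)
      (RelSeries.head l).asIdeal ⊥ (by
        intro x hx
        have : algebraMap R S x = 0 := by simpa using hx
        have : x = 0 := hf (by rw [map_zero]; exact this)
        rw [this]; exact zero_mem _)
    have : Q.LiesOver (RelSeries.head l).asIdeal := ⟨hQ'.symm⟩
    obtain ⟨L, hL, -⟩ := Ideal.exists_ltSeries_of_hasGoingUp (S := S) l Q
    rw [← hL]
    exact Order.LTSeries.length_le_krullDim L

lemma jk_dvd_of_integral {B L : Type*} [CommRing B] [IsDomain B] [CommRing L] [IsDomain L]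
    [IsIntegrallyClosed L] (φ : B →+* L) (hφ : Function.Injective φ) (a b : B) (hb : b ≠ 0)
    (h : IsIntegral B (algebraMap B (FractionRing B) a / algebraMap B (FractionRing B) b)) :
    φ b ∣ φ a := by
  let Φ : FractionRing B →+* FractionRing L := IsFractionRing.map hφ
  have hΦ : ∀ c, Φ (algebraMap B (FractionRing B) c) = algebraMap L (FractionRing L) (φ c) := by
    intro c; simp [Φ, IsFractionRing.map]
  have h2 : IsIntegral L (Φ (algebraMap B (FractionRing B) a / algebraMap B (FractionRing B) b)) := by
    obtain ⟨p, hp, hpe⟩ := h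
    refine ⟨p.map φ, hp.map φ, ?_⟩
    rw [Polynomial.eval₂_map]
    have : (algebraMap L (FractionRing L)).comp φ = Φ.comp (algebraMap B (FractionRing B)) := by
      ext c; simp [hΦ]
    rw [this, ← Polynomial.hom_eval₂, hpe, map_zero]
  obtain ⟨g, hg⟩ := (isIntegrallyClosed_iff (FractionRing L)).1 inferInstance h2
  refine ⟨g, IsFractionRing.injective L (FractionRing L) ?_⟩
  have hb' : algebraMap L (FractionRing L) (φ b) ≠ 0 := by
    rw [← hΦ]; simpa using hb
  rw [map_mul, hg, map_div₀, hΦ, hΦ, mul_div_cancel₀ _ hb']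

lemma jk_closed_of_two {B L M : Type*} [CommRing B] [IsDomain B] [CommRing L] [IsDomain L]
    [IsIntegrallyClosed L] [CommRing M] [IsDomain M]
    [IsIntegrallyClosed M] (φ : B →+* L) (hφ : Function.Injective φ) (ψ : B →+* M)
    (hψ : Function.Injective ψ) 
    (H : ∀ a b, b ≠ 0 → φ b ∣ φ a → ψ b ∣ ψ a → b ∣ a) : IsIntegrallyClosed B := by
  rw [isIntegrallyClosed_iff (FractionRing B)]
  intro y hy
  obtain ⟨a, b, hb, rfl⟩ := IsFractionRing.div_surjective (A := B) y
  have hb0 : b ≠ 0 := nonZeroDivisors.ne_zero hb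
  obtain ⟨c, hc⟩ := H a b hb0 (jk_dvd_of_integral φ hφ a b hb0 hy)
    (jk_dvd_of_integral ψ hψ a b hb0 hy)
  refine ⟨c, ?_⟩
  have hb' : algebraMap B (FractionRing B) b ≠ 0 := by simpa using hb0
  rw [hc, map_mul, mul_div_cancel_left₀ _ hb']

/-- The scaling automorphism `h ↦ u h`, `z ↦ u² z` of `k[h, z]`. -/
noncomputable def jkS {k : Type*} [Field k] (u : k) :
    MvPolynomial (Fin 2) k →ₐ[k] MvPolynomial (Fin 2) k :=
  MvPolynomial.aeval ![MvPolynomial.C u * MvPolynomial.X 0,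
    MvPolynomial.C (u ^ 2) * MvPolynomial.X 1]

lemma jkS_X0 {k : Type*} [Field k] (u : k) :
    jkS u (MvPolynomial.X 0) = MvPolynomial.C u * MvPolynomial.X 0 := by simp [jkS]

lemma jkS_X1 {k : Type*} [Field k] (u : k) :
    jkS u (MvPolynomial.X 1) = MvPolynomial.C (u ^ 2) * MvPolynomial.X 1 := by simp [jkS]

lemma jkS_C {k : Type*} [Field k] (u c : k) :
    jkS u (MvPolynomial.C c) = MvPolynomial.C c := by simp [jkS]

lemma jkS_jkS {k : Type*} [Field k] (u v : k) (d : MvPolynomial (Fin 2) k) :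
    jkS u (jkS v d) = jkS (u * v) d := by
  have : (jkS u).comp (jkS v) = jkS (u * v) := by
    ext1 i
    fin_cases i
    · simp only [AlgHom.comp_apply, Fin.zero_eta, jkS_X0, map_mul, jkS_C]; ring
    · simp only [AlgHom.comp_apply, Fin.mk_one, jkS_X1, map_mul, jkS_C, map_pow]; ring
  exact DFunLike.congr_fun this d

lemma jkS_one {k : Type*} [Field k] (d : MvPolynomial (Fin 2) k) : jkS 1 d = d := by
  have : jkS (1 : k) = AlgHom.id k _ := by
    ext1 i
    fin_cases i <;> simp [jkS]
  rw [this]; rfl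

lemma jkS_injective {k : Type*} [Field k] (u : k) (hu : u ≠ 0) : Function.Injective (jkS u) := by
  intro a b h
  have := congrArg (jkS u⁻¹) h
  simpa only [jkS_jkS, inv_mul_cancel₀ hu, jkS_one] using this

/-- The element `t = z - a h + x`. -/
noncomputable def jkT {k : Type*} [Field k] (a x : k) : MvPolynomial (Fin 2) k :=
  MvPolynomial.X 1 - MvPolynomial.C a * MvPolynomial.X 0 + MvPolynomial.C x

lemma jkT_ne_zero {k : Type*} [Field k] (a x : k) : jkT a x ≠ 0 := by
  intro h
  have h1 := congrArg (MvPolynomial.eval ![0, 1 - x]) h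
  have h2 := congrArg (MvPolynomial.eval ![0, - x]) h
  simp [jkT] at h1 

/-- The products `t σ⁻¹(t) ⋯ σ^{-(m-1)}(t)`. -/
noncomputable def jkN {k : Type*} [Field k] (q a x : k) (m : ℕ) : MvPolynomial (Fin 2) k :=
  ∏ i ∈ Finset.range m, jkS (q⁻¹ ^ i) (jkT a x)

lemma jkN_succ {k : Type*} [Field k] (q a x : k) (m : ℕ) :
    jkN q a x (m + 1) = jkT a x * jkS q⁻¹ (jkN q a x m) := by
  rw [jkN, Finset.prod_range_succ', jkN, map_prod, mul_comm]
  simp only [jkS_jkS, pow_zero, jkS_one, pow_succ']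

lemma jkN_ne_zero {k : Type*} [Field k] (q a x : k) (hq : q ≠ 0) (m : ℕ) : jkN q a x m ≠ 0 := by
  refine Finset.prod_ne_zero_iff.2 fun i _ => ?_
  exact (map_ne_zero_iff _ (jkS_injective _ (pow_ne_zero _ (inv_ne_zero hq)))).2 (jkT_ne_zero a x)

lemma jkN_mul {k : Type*} [Field k] (q a x : k) (n : ℕ) (hn : q ^ n = 1) (j : ℕ) :
    jkN q a x (n * j) = jkN q a x n ^ j := by
  induction j with
  | zero => simp [jkN]
  | succ j ih =>
    rw [pow_succ, ← ih, Nat.mul_succ]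
    simp only [jkN]
    rw [Finset.prod_range_add]
    congr 1
    refine Finset.prod_congr rfl fun i _ => ?_
    rw [pow_add, pow_mul, inv_pow, hn, inv_one, one_pow, one_mul]

lemma jkN_inv {k : Type*} [Field k] (q a x : k) (hq : q ≠ 0) (n : ℕ) (hn : q ^ n = 1) :
    jkS q (jkN q a x n) = jkN q a x n := by
  have h : jkS q⁻¹ (jkN q a x n) = jkN q a x n := by
    have h1 := jkN_succ q a x n
    rw [jkN, Finset.prod_range_succ, ← jkN, inv_pow, hn, inv_one, jkS_one, mul_comm] at h1
    exact (mul_left_cancel₀ (jkT_ne_zero a x) h1).symm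
  conv_lhs => rw [← h]
  rw [jkS_jkS, mul_inv_cancel₀ hq, jkS_one]

/-- The normalising coefficients `τ_i`. -/
noncomputable def jkTau {k : Type*} [Field k] (q a x : k) : ℤ → MvPolynomial (Fin 2) k
  | .ofNat _ => 1
  | .negSucc m => jkN q a x (m + 1)

lemma jkTau_ne_zero {k : Type*} [Field k] (q a x : k) (hq : q ≠ 0) (i : ℤ) :
    jkTau q a x i ≠ 0 := by
  cases i with
  | ofNat m => exact one_ne_zero
  | negSucc m => exact jkN_ne_zero q a x hq _

/-- `σ_u` on Laurent polynomials, coefficientwise. -/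
noncomputable def jkSL {k : Type*} [Field k] (u : k) :
    LaurentPolynomial (MvPolynomial (Fin 2) k) →ₐ[k] LaurentPolynomial (MvPolynomial (Fin 2) k) :=
  AddMonoidAlgebra.mapAlgHom ℤ (jkS u)

lemma jkSL_coeff {k : Type*} [Field k] (u : k) (g : LaurentPolynomial (MvPolynomial (Fin 2) k))
    (i : ℤ) : (jkSL u g).coeff i = jkS u (g.coeff i) := by simp [jkSL]

lemma jkSL_C {k : Type*} [Field k] (u : k) (d : MvPolynomial (Fin 2) k) :
    jkSL u (C d) = C (jkS u d) := by
  rw [← single_eq_C, jkSL, AddMonoidAlgebra.mapAlgHom_single, single_eq_C]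

lemma jkSL_T {k : Type*} [Field k] (u : k) (i : ℤ) : jkSL u (T i) = T i := by
  rw [T, jkSL, AddMonoidAlgebra.mapAlgHom_single, map_one]

lemma jkSL_jkSL {k : Type*} [Field k] (u v : k)
    (g : LaurentPolynomial (MvPolynomial (Fin 2) k)) :
    jkSL u (jkSL v g) = jkSL (u * v) g := by
  apply LaurentPolynomial.ext
  intro i
  simp only [jkSL_coeff, jkS_jkS]

lemma jkSL_one {k : Type*} [Field k] 
    (g : LaurentPolynomial (MvPolynomial (Fin 2) k)) : jkSL 1 g = g := by
  apply LaurentPolynomial.ext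
  intro i
  simp only [jkSL_coeff, jkS_one]

/-- A faithful-to-be action of the Jackson algebra by twisted operators. -/
structure JkSetup (k : Type*) [Field k] (q a x : k) (A : Type*) [Ring A] [Algebra k A] where
  e0 : A
  e1 : A
  e2 : A
  dl : MvPolynomial (Fin 2) k →ₐ[k] A
  rho : A →ₐ[k] Module.End k (LaurentPolynomial (MvPolynomial (Fin 2) k))
  dl0 : dl (MvPolynomial.X 0) = e0
  e1d : ∀ d, e1 * dl d = dl (jkS q⁻¹ d) * e1
  e2d : ∀ d, e2 * dl d = dl (jkS q d) * e2
  e12 : e1 * e2 = dl (jkT a x)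
  e21 : e2 * e1 = dl (jkS q (jkT a x))
  gen : Algebra.adjoin k {e0, e1, e2} = ⊤
  rho1 : ∀ m, rho e1 m = C (jkT a x) * T (-1) * jkSL q⁻¹ m
  rho2 : ∀ m, rho e2 m = T 1 * jkSL q m
  rhod : ∀ d m, rho (dl d) m = C d * m

namespace JkSetup

variable {k : Type*} [Field k] {q a x : k} {A : Type*} [Ring A] [Algebra k A]
  (J : JkSetup k q a x A)

lemma rho0 (m) : J.rho J.e0 m = C (MvPolynomial.X 0) * m := by rw [← J.dl0, J.rhod]

lemma induct {P : A → Prop} (h0 : P J.e0) (h1 : P J.e1) (h2 : P J.e2)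
    (hc : ∀ c : k, P (algebraMap k A c)) (ha : ∀ a b, P a → P b → P (a + b))
    (hm : ∀ a b, P a → P b → P (a * b)) (b : A) : P b := by
  have hb : b ∈ Algebra.adjoin k {J.e0, J.e1, J.e2} := by rw [J.gen]; trivial
  induction hb using Algebra.adjoin_induction with
  | mem y hy => rcases hy with rfl | rfl | rfl <;> assumption
  | algebraMap c => exact hc c
  | add a b _ _ h1 h2 => exact ha a b h1 h2
  | mul a b _ _ h1 h2 => exact hm a b h1 h2

/-- `ρ(b)` commutes with any `k`-linear operator commuting with generators. -/
lemma rho_comm (F : LaurentPolynomial (MvPolynomial (Fin 2) k) →ₗ[k]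
      LaurentPolynomial (MvPolynomial (Fin 2) k))
    (h0 : ∀ m, J.rho J.e0 (F m) = F (J.rho J.e0 m))
    (h1 : ∀ m, J.rho J.e1 (F m) = F (J.rho J.e1 m))
    (h2 : ∀ m, J.rho J.e2 (F m) = F (J.rho J.e2 m)) (b : A) :
    ∀ m, J.rho b (F m) = F (J.rho b m) := by
  induction b using J.induct with
  | h0 => exact h0
  | h1 => exact h1
  | h2 => exact h2
  | hc c => intro m; simp
  | ha a b h1 h2 => intro m; simp [h1, h2]
  | hm a b h1 h2 => intro m; simp [h1, h2]

lemma rho_T (b : A) (i : ℤ) (m) : J.rho b (T i * m) = T i * J.rho b m := by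
  have := J.rho_comm (LinearMap.mulLeft k (T i)) (fun m => ?_) (fun m => ?_) (fun m => ?_) b m
  · simpa using this
  · simp only [LinearMap.mulLeft_apply, rho0]; ring
  · simp only [LinearMap.mulLeft_apply, rho1, map_mul, jkSL_T]; ring
  · simp only [LinearMap.mulLeft_apply, rho2, map_mul, jkSL_T]; ring

end JkSetup

/-- The automorphism `T ↦ u T`. -/
noncomputable def jkMu {k : Type*} [Field k] (u : kˣ) :
    LaurentPolynomial (MvPolynomial (Fin 2) k) →ₐ[k] LaurentPolynomial (MvPolynomial (Fin 2) k) where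
  toRingHom := jkScale (RingHom.id _) (Units.map (MvPolynomial.C (σ := Fin 2)).toMonoidHom u)
  commutes' := by
    intro c
    have := jkScale_C_mul_T (RingHom.id (MvPolynomial (Fin 2) k)) 
      (Units.map (MvPolynomial.C (σ := Fin 2)).toMonoidHom u) (MvPolynomial.C c) 0
    simpa using this

lemma jkMu_coeff {k : Type*} [Field k] (u : kˣ)
    (g : LaurentPolynomial (MvPolynomial (Fin 2) k)) (i : ℤ) :
    (jkMu u g).coeff i = g.coeff i * MvPolynomial.C ((u : k) ^ i) := by
  have := jkScale_coeff (RingHom.id (MvPolynomial (Fin 2) k)) 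
      (Units.map (MvPolynomial.C (σ := Fin 2)).toMonoidHom u) g i
  rw [← map_zpow] at this
  refine this.trans ?_
  rw [← Units.val_zpow_eq_zpow_val]
  rfl

lemma jkMu_C {k : Type*} [Field k] (u : kˣ) (d : MvPolynomial (Fin 2) k) :
    jkMu u (C d) = C d := by
  apply LaurentPolynomial.ext
  intro i
  rw [jkMu_coeff]
  by_cases h : i = 0 <;> simp [h]

lemma jkMu_T {k : Type*} [Field k] (u : kˣ) (j : ℤ) :
    jkMu u (T j) = C (MvPolynomial.C ((u : k) ^ j)) * T j := by
  apply LaurentPolynomial.ext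
  intro i
  rw [jkMu_coeff, jk_coeff_C_mul]
  by_cases h : j = i <;> simp [h]

lemma jkMu_jkSL {k : Type*} [Field k] (u : kˣ) (v : k)
    (g : LaurentPolynomial (MvPolynomial (Fin 2) k)) :
    jkMu u (jkSL v g) = jkSL v (jkMu u g) := by
  apply LaurentPolynomial.ext
  intro i
  simp only [jkMu_coeff, jkSL_coeff, map_mul, jkS_C]

namespace JkSetup

variable {k : Type*} [Field k] {a x : k} {q : kˣ} {A : Type*} [Ring A] [Algebra k A]
  (J : JkSetup k q a x A)

lemma rho_h (b : A) (m) : J.rho b (C (MvPolynomial.X 0) * jkMu q m) =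
    C (MvPolynomial.X 0) * jkMu q (J.rho b m) := by
  have hq : (q : k) ≠ 0 := q.ne_zero
  have := J.rho_comm ((LinearMap.mulLeft k (C (MvPolynomial.X 0))).comp (jkMu q).toLinearMap)
    (fun m => ?_) (fun m => ?_) (fun m => ?_) b m
  · simpa using this
  · simp only [LinearMap.comp_apply, AlgHom.toLinearMap_apply, LinearMap.mulLeft_apply, rho0,
      map_mul, jkMu_C]
  · have h1 : (C (MvPolynomial.C (q : k)⁻¹) : LaurentPolynomial (MvPolynomial (Fin 2) k)) =
      C (MvPolynomial.C ((q : k) ^ (-1 : ℤ))) := by simp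
    simp only [LinearMap.comp_apply, AlgHom.toLinearMap_apply, LinearMap.mulLeft_apply, rho1,
      map_mul, jkMu_C, jkSL_C, jkS_X0, jkMu_jkSL, jkMu_T]
    rw [h1]; ring
  · simp only [LinearMap.comp_apply, AlgHom.toLinearMap_apply, LinearMap.mulLeft_apply, rho2,
      map_mul, jkSL_C, jkS_X0, jkMu_jkSL, jkMu_T, zpow_one]
    ring

lemma rho_z (b : A) (m) : J.rho b (C (MvPolynomial.X 1) * jkMu q (jkMu q m)) =
    C (MvPolynomial.X 1) * jkMu q (jkMu q (J.rho b m)) := by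
  have hq : (q : k) ≠ 0 := q.ne_zero
  have := J.rho_comm ((LinearMap.mulLeft k (C (MvPolynomial.X 1))).comp
    ((jkMu q).toLinearMap.comp (jkMu q).toLinearMap))
    (fun m => ?_) (fun m => ?_) (fun m => ?_) b m
  · simpa using this
  · simp only [LinearMap.comp_apply, AlgHom.toLinearMap_apply, LinearMap.mulLeft_apply, rho0,
      map_mul, jkMu_C]
    ring
  · have h1 : (C (MvPolynomial.C ((q : k)⁻¹ ^ 2)) : LaurentPolynomial (MvPolynomial (Fin 2) k)) =
      C (MvPolynomial.C ((q : k) ^ (-1 : ℤ))) * C (MvPolynomial.C ((q : k) ^ (-1 : ℤ))) := by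
      simp [sq]
    simp only [LinearMap.comp_apply, AlgHom.toLinearMap_apply, LinearMap.mulLeft_apply, rho1,
      map_mul, jkMu_C, jkSL_C, jkS_X1, jkMu_jkSL, jkMu_T]
    rw [h1]; ring
  · have h1 : (C (MvPolynomial.C ((q : k) ^ 2)) : LaurentPolynomial (MvPolynomial (Fin 2) k)) =
      C (MvPolynomial.C (q : k)) * C (MvPolynomial.C (q : k)) := by
      simp [sq]
    simp only [LinearMap.comp_apply, AlgHom.toLinearMap_apply, LinearMap.mulLeft_apply, rho2,
      map_mul, jkMu_C, jkSL_C, jkS_X1, jkMu_jkSL, jkMu_T, zpow_one]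
    rw [h1]; ring

end JkSetup

namespace JkSetup

section
variable {k : Type*} [Field k] {q a x : k} {A : Type*} [Ring A] [Algebra k A]
  (J : JkSetup k q a x A)

/-- The elements `v_i`: powers of `e₂` for `i ≥ 0`, powers of `e₁` for `i < 0`. -/
def v : ℤ → A
  | .ofNat m => J.e2 ^ m
  | .negSucc m => J.e1 ^ (m + 1)

lemma v_nat (m : ℕ) : J.v (m : ℤ) = J.e2 ^ m := rfl

lemma v_neg (m : ℕ) : J.v (-(m : ℤ)) = J.e1 ^ m := by
  cases m with
  | zero => simp [v_nat J 0 |> (by simpa using ·)]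
  | succ m => rfl

/-- The set of finite sums of `δ(d) v_i`. -/
def sp : AddSubmonoid A := AddSubmonoid.closure {b | ∃ d i, b = J.dl d * J.v i}

lemma mem_sp (d i) : J.dl d * J.v i ∈ J.sp := AddSubmonoid.subset_closure ⟨d, i, rfl⟩

lemma dl_mul_sp (d : MvPolynomial (Fin 2) k) (b : A) (hb : b ∈ J.sp) : J.dl d * b ∈ J.sp := by
  induction hb using AddSubmonoid.closure_induction with
  | mem y hy =>
    obtain ⟨d', i, rfl⟩ := hy
    rw [← mul_assoc, ← map_mul]
    exact J.mem_sp _ _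
  | zero => simp
  | add y z _ _ h1 h2 => rw [mul_add]; exact add_mem h1 h2

lemma e2_mul_sp (b : A) (hb : b ∈ J.sp) : J.e2 * b ∈ J.sp := by
  induction hb using AddSubmonoid.closure_induction with
  | mem y hy =>
    obtain ⟨d', i, rfl⟩ := hy
    rw [← mul_assoc, J.e2d, mul_assoc]
    apply dl_mul_sp
    obtain ⟨m, rfl | rfl⟩ := Int.eq_nat_or_neg i
    · have := J.mem_sp 1 ((m + 1 : ℕ) : ℤ)
      rwa [map_one, one_mul, v_nat, pow_succ', ← v_nat] at this
    · cases m with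
      | zero => 
        have := J.mem_sp 1 1
        rw [map_one, one_mul] at this
        rw [v_neg]
        simpa [v] using this
      | succ m =>
        rw [v_neg, pow_succ', ← mul_assoc, J.e21, ← v_neg]
        exact J.mem_sp _ _
  | zero => simp
  | add y z _ _ h1 h2 => rw [mul_add]; exact add_mem h1 h2

lemma e1_mul_sp (b : A) (hb : b ∈ J.sp) : J.e1 * b ∈ J.sp := by
  induction hb using AddSubmonoid.closure_induction with
  | mem y hy =>
    obtain ⟨d', i, rfl⟩ := hy
    rw [← mul_assoc, J.e1d, mul_assoc]
    apply dl_mul_sp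
    obtain ⟨m, rfl | rfl⟩ := Int.eq_nat_or_neg i
    · cases m with
      | zero => 
        have := J.mem_sp 1 (-1)
        rw [map_one, one_mul] at this
        rw [v_nat]
        have h1 := J.v_neg 1
        simp only [Nat.cast_one] at h1
        rw [h1] at this
        simpa using this
      | succ m =>
        rw [v_nat, pow_succ', ← mul_assoc, J.e12, ← v_nat]
        exact J.mem_sp _ _
    · have := J.mem_sp 1 (-((m + 1 : ℕ) : ℤ))
      rwa [map_one, one_mul, v_neg, pow_succ', ← v_neg] at this
  | zero => simp
  | add y z _ _ h1 h2 => rw [mul_add]; exact add_mem h1 h2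

lemma sp_top (b : A) : b ∈ J.sp := by
  suffices h : ∀ c ∈ J.sp, b * c ∈ J.sp by
    have h1 := J.mem_sp 1 0
    have h2 := h _ h1
    have h3 : J.v 0 = 1 := by simpa using J.v_nat 0
    simpa [h3] using h2
  induction b using J.induct with
  | h0 => intro c hc; rw [← J.dl0]; exact J.dl_mul_sp _ _ hc
  | h1 => exact J.e1_mul_sp
  | h2 => exact J.e2_mul_sp
  | hc r => intro c hc; rw [← J.dl.commutes]; exact J.dl_mul_sp _ _ hc
  | ha a b h1 h2 => intro c hc; rw [add_mul]; exact add_mem (h1 c hc) (h2 c hc)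
  | hm a b h1 h2 => intro c hc; rw [mul_assoc]; exact h1 _ (h2 c hc)

lemma rho_v (i : ℤ) : J.rho (J.v i) 1 = C (jkTau q a x i) * T i := by
  cases i with
  | ofNat m =>
    change J.rho (J.e2 ^ m) 1 = C 1 * T (m : ℤ)
    induction m with
    | zero => simp
    | succ m ih =>
      rw [pow_succ', map_mul, Module.End.mul_apply, ih, rho2, map_mul, jkSL_T, jkSL_C, map_one,
        mul_left_comm, ← T_add]
      congr 2; push_cast; ring
  | negSucc m =>
    change J.rho (J.e1 ^ (m + 1)) 1 = C (jkN q a x (m + 1)) * T (-((m + 1 : ℕ) : ℤ))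
    generalize m + 1 = m
    induction m with
    | zero => simp [jkN]
    | succ m ih =>
      rw [pow_succ', map_mul, Module.End.mul_apply, ih, rho1, map_mul, jkSL_T, jkSL_C, jkN_succ,
        map_mul C, mul_mul_mul_comm, ← T_add]
      congr 2; push_cast; ring

/-- The sum `∑ δ(f_i) v_i`. -/
noncomputable def s : LaurentPolynomial (MvPolynomial (Fin 2) k) →+ A where
  toFun f := Finsupp.liftAddHom
    (fun i => (AddMonoidHom.mulRight (J.v i)).comp J.dl.toRingHom.toAddMonoidHom) f.coeff
  map_zero' := by simp
  map_add' f g := by rw [AddMonoidAlgebra.coeff_add, map_add]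

lemma s_CT (d : MvPolynomial (Fin 2) k) (i : ℤ) : J.s (C d * T i) = J.dl d * J.v i := by
  rw [← single_eq_C_mul_T]
  change Finsupp.liftAddHom
    (fun i => (AddMonoidHom.mulRight (J.v i)).comp J.dl.toRingHom.toAddMonoidHom)
      (AddMonoidAlgebra.single i d).coeff = _
  rw [AddMonoidAlgebra.coeff_single, Finsupp.liftAddHom_apply_single]
  rfl

lemma s_surj (b : A) : ∃ f, J.s f = b := by
  have hb := J.sp_top b
  change b ∈ AddMonoidHom.mrange J.s
  refine (AddSubmonoid.closure_le.2 ?_ : J.sp ≤ _) hb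
  rintro _ ⟨d, i, rfl⟩
  exact ⟨C d * T i, J.s_CT d i⟩

lemma rho_s_coeff (f) (i : ℤ) : (J.rho (J.s f) 1).coeff i = f.coeff i * jkTau q a x i := by
  induction f using LaurentPolynomial.induction_on' with
  | add f g hf hg => simp [hf, hg, add_mul]
  | C_mul_T n d =>
    rw [s_CT, map_mul, Module.End.mul_apply, rho_v, rhod, ← mul_assoc, ← map_mul,
      ← single_eq_C_mul_T, ← single_eq_C_mul_T]
    simp only [AddMonoidAlgebra.coeff_single, Finsupp.single_apply]
    by_cases h : n = i <;> simp [h]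

lemma rho_one_inj (hq : q ≠ 0) (b c : A) (h : J.rho b 1 = J.rho c 1) : b = c := by
  replace h : J.rho (b - c) 1 = 0 := by rw [map_sub, LinearMap.sub_apply, h, sub_self]
  rw [← sub_eq_zero]
  obtain ⟨f, hf⟩ := J.s_surj (b - c)
  rw [← hf] at h ⊢
  have : f = 0 := by
    apply LaurentPolynomial.ext
    intro i
    have h1 := J.rho_s_coeff f i
    rw [h] at h1
    have h2 : 0 = f.coeff i * jkTau q a x i := by simpa using h1
    rcases mul_eq_zero.1 h2.symm with h3 | h3
    · simpa using h3
    · exact absurd h3 (jkTau_ne_zero q a x hq i)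
  rw [this, map_zero]

lemma tau_dvd (b : A) (i : ℤ) : jkTau q a x i ∣ (J.rho b 1).coeff i := by
  obtain ⟨f, rfl⟩ := J.s_surj b
  rw [J.rho_s_coeff]
  exact Dvd.intro_left _ rfl

lemma exists_of_dvd (g : LaurentPolynomial (MvPolynomial (Fin 2) k))
    (h : ∀ i, jkTau q a x i ∣ g.coeff i) : ∃ b, J.rho b 1 = g := by
  choose d hd using h
  refine ⟨∑ i ∈ g.coeff.support, J.dl (d i) * J.v i, ?_⟩
  conv_rhs => rw [jk_laurent_sum g]
  rw [map_sum, LinearMap.sum_apply]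
  refine Finset.sum_congr rfl fun i _ => ?_
  rw [map_mul, Module.End.mul_apply, rho_v, rhod, hd i, ← mul_assoc, ← map_mul, mul_comm (d i)]

lemma central_rho (c : A) (hc : ∀ b, b * c = c * b) (m) : J.rho c m = m * J.rho c 1 := by
  induction m using LaurentPolynomial.induction_on' with
  | add f g hf hg => rw [map_add, hf, hg, add_mul]
  | C_mul_T n d =>
    rw [← J.rhod d (T n), ← Module.End.mul_apply, ← map_mul, ← hc, map_mul, Module.End.mul_apply,
      rhod, rhod, mul_assoc]
    congr 1
    have := J.rho_T c n 1
    rwa [mul_one] at this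

end

variable {k : Type*} [Field k] {a x : k} {q : kˣ} {A : Type*} [Ring A] [Algebra k A]
  (J : JkSetup k q a x A)

lemma central_inv (c : A) (hc : ∀ b, b * c = c * b) :
    jkSL (q : k) (J.rho c 1) = J.rho c 1 ∧ jkMu q (J.rho c 1) = J.rho c 1 := by
  constructor
  · have h1 : J.rho (J.e2 * c) 1 = J.rho (c * J.e2) 1 := by rw [hc]
    rw [map_mul, map_mul, Module.End.mul_apply, Module.End.mul_apply, rho2, rho2,
      map_one (jkSL _), rho_T] at h1
    exact (isUnit_T (R := MvPolynomial (Fin 2) k) 1).mul_left_cancel h1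
  · have h1 : J.rho (J.e0 * c) 1 = J.rho (c * J.e0) 1 := by rw [hc]
    have h2 := J.rho_h c 1
    rw [map_mul, map_mul, Module.End.mul_apply, Module.End.mul_apply, rho0, rho0] at h1
    rw [mul_one] at h1
    rw [map_one (jkMu q), mul_one, ← h1] at h2
    apply LaurentPolynomial.ext
    intro i
    have h3 := congrArg (fun g => g.coeff i) h2
    simp only [jk_coeff_C_mul] at h3
    exact (mul_left_cancel₀ (MvPolynomial.X_ne_zero 0) h3).symm

lemma rho_t (c : A) (hh : J.rho c (C (MvPolynomial.X 0)) = C (MvPolynomial.X 0) * J.rho c 1)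
    (hz : J.rho c (C (MvPolynomial.X 1)) = C (MvPolynomial.X 1) * J.rho c 1) :
    J.rho c (C (jkT a x)) = C (jkT a x) * J.rho c 1 := by
  have h4 : ∀ r : k, ∀ m : LaurentPolynomial (MvPolynomial (Fin 2) k),
      C (MvPolynomial.C r) * m = r • m := by
    intro r m
    apply LaurentPolynomial.ext
    intro i
    rw [jk_coeff_C_mul, AddMonoidAlgebra.coeff_smul, Finsupp.smul_apply, MvPolynomial.smul_eq_C_mul]
  have h5 : (C (jkT a x) : LaurentPolynomial (MvPolynomial (Fin 2) k)) =
      C (MvPolynomial.X 1) - a • C (MvPolynomial.X 0) + x • 1 := by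
    rw [← h4, ← h4, mul_one, jkT, map_add, map_sub, map_mul]
  rw [h5, map_add, map_sub, LinearMap.map_smul, LinearMap.map_smul, hh, hz, add_mul, sub_mul,
    smul_mul_assoc, smul_mul_assoc, one_mul]

lemma central_of_inv (c : A) (h1 : jkSL (q : k) (J.rho c 1) = J.rho c 1)
    (h2 : jkMu q (J.rho c 1) = J.rho c 1) (b : A) : b * c = c * b := by
  have hh : J.rho c (C (MvPolynomial.X 0)) = C (MvPolynomial.X 0) * J.rho c 1 := by
    have := J.rho_h c 1
    rwa [map_one (jkMu q), mul_one, h2] at this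
  have hz : J.rho c (C (MvPolynomial.X 1)) = C (MvPolynomial.X 1) * J.rho c 1 := by
    have := J.rho_z c 1
    rwa [map_one (jkMu q), map_one (jkMu q), mul_one, h2, h2] at this
  have hi := J.rho_one_inj q.ne_zero
  induction b using J.induct with
  | h0 =>
    apply hi
    rw [map_mul, map_mul, Module.End.mul_apply, Module.End.mul_apply, rho0, rho0, mul_one, hh]
  | h1 =>
    apply hi
    rw [map_mul, map_mul, Module.End.mul_apply, Module.End.mul_apply, rho1, rho1,
      map_one (jkSL _), mul_one]
    have h3 : jkSL (q : k)⁻¹ (J.rho c 1) = J.rho c 1 := by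
      conv_lhs => rw [← h1]
      rw [jkSL_jkSL, inv_mul_cancel₀ q.ne_zero, jkSL_one]
    rw [h3, mul_comm (C (jkT a x)) (T (-1)), rho_T, mul_assoc, J.rho_t c hh hz]
  | h2 =>
    apply hi
    rw [map_mul, map_mul, Module.End.mul_apply, Module.End.mul_apply, rho2, rho2,
      map_one (jkSL _),
      rho_T, h1]
  | hc r => exact Algebra.commutes _ _
  | ha y z h1 h2 => rw [add_mul, mul_add, h1, h2]
  | hm y z h1 h2 => rw [mul_assoc, h2, ← mul_assoc, h1, mul_assoc]

/-- The commutative embedding of the centre. -/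
noncomputable def phi : Subalgebra.center k A →+* LaurentPolynomial (MvPolynomial (Fin 2) k) where
  toFun c := J.rho c 1
  map_one' := by simp
  map_zero' := by simp
  map_add' c d := by simp
  map_mul' c d := by
    rw [MulMemClass.coe_mul, map_mul, Module.End.mul_apply,
      J.central_rho c (Subalgebra.mem_center_iff.1 c.2), mul_comm]

lemma phi_inj : Function.Injective J.phi := fun c d h =>
  Subtype.ext (J.rho_one_inj q.ne_zero _ _ h)

lemma phi_range (g) : (∃ c, J.phi c = g) ↔
    jkSL (q : k) g = g ∧ jkMu q g = g ∧ ∀ i, jkTau (q : k) a x i ∣ g.coeff i := by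
  constructor
  · rintro ⟨c, rfl⟩
    have := J.central_inv c (Subalgebra.mem_center_iff.1 c.2)
    exact ⟨this.1, this.2, J.tau_dvd _⟩
  · rintro ⟨h1, h2, h3⟩
    obtain ⟨b, rfl⟩ := J.exists_of_dvd g h3
    exact ⟨⟨b, Subalgebra.mem_center_iff.2 (J.central_of_inv b h1 h2)⟩, rfl⟩

end JkSetup

lemma jkScale_injective {R S : Type*} [CommRing R] [CommRing S] (f : R →+* S)
    (hf : Function.Injective f) (u : Sˣ) : Function.Injective (jkScale f u) := by
  intro g h hgh
  apply LaurentPolynomial.ext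
  intro i
  have h1 := congrArg (fun p => p.coeff i) hgh
  simp only [jkScale_coeff] at h1
  exact hf ((u ^ i).isUnit.mul_right_cancel h1)

lemma jkTau_neg {k : Type*} [Field k] (q a x : k) (m : ℕ) :
    jkTau q a x (-(m : ℤ)) = jkN q a x m := by
  cases m with
  | zero => simp only [jkN, Finset.range_zero, Finset.prod_empty]; rfl
  | succ m => rfl

lemma jk_mu_supp {k : Type*} [Field k] {q : kˣ} {n : ℕ} (hq : IsPrimitiveRoot (q : k) n)
    (g : LaurentPolynomial (MvPolynomial (Fin 2) k)) (h : jkMu q g = g) (i : ℤ)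
    (hi : ¬ (n : ℤ) ∣ i) : g.coeff i = 0 := by
  have h1 := congrArg (fun p => p.coeff i) h
  simp only [jkMu_coeff] at h1
  by_contra h0
  have h2 : MvPolynomial.C (σ := Fin 2) ((q : k) ^ i) = 1 :=
    mul_left_cancel₀ h0 (by rw [h1, mul_one])
  rw [← map_one MvPolynomial.C] at h2
  exact hi ((hq.zpow_eq_one_iff_dvd i).1 (MvPolynomial.C_injective _ _ h2))

lemma jk_int_cases {n : ℕ} {i : ℤ} (h : (n : ℤ) ∣ i) :
    (∃ m : ℕ, i = ((n * m : ℕ) : ℤ)) ∨ ∃ m : ℕ, i = -((n * m : ℕ) : ℤ) := by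
  obtain ⟨j, rfl⟩ := h
  obtain ⟨m, rfl | rfl⟩ := Int.eq_nat_or_neg j
  · exact Or.inl ⟨m, by push_cast; ring⟩
  · exact Or.inr ⟨m, by push_cast; ring⟩

lemma jk_int_sum {R S ι : Type*} [CommRing R] [CommRing S] (F : R →+* S) (s : Finset ι)
    (g : ι → S) (h : ∀ i ∈ s, F.IsIntegralElem (g i)) : F.IsIntegralElem (∑ i ∈ s, g i) := by
  let := F.toAlgebra
  exact IsIntegral.sum (R := R) (s := s) g h

lemma jk_int_pow {R S : Type*} [CommRing R] [CommRing S] (F : R →+* S) 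
    (y : S) (h : F.IsIntegralElem y) (m : ℕ) : F.IsIntegralElem (y ^ m) := by
  let := F.toAlgebra
  exact IsIntegral.pow (R := R) h m

lemma jk_int_of_pow {R S : Type*} [CommRing R] [CommRing S] (F : R →+* S) 
    (y : S) (m : ℕ) (hm : 0 < m) (h : F.IsIntegralElem (y ^ m)) : F.IsIntegralElem y := by
  let := F.toAlgebra
  exact IsIntegral.of_pow (R := R) hm h

lemma jk_int_quad {R S : Type*} [CommRing R] [CommRing S] (F : R →+* S) 
    (u v y : S) (hu : F.IsIntegralElem u) (hv : F.IsIntegralElem v)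
    (h : y ^ 2 - u * y + v = 0) : F.IsIntegralElem y := by
  let := F.toAlgebra
  have hu' : u ∈ integralClosure R S := hu
  have hv' : v ∈ integralClosure R S := hv
  have : IsIntegral (integralClosure R S) y := by
    refine ⟨Polynomial.X ^ 2 - Polynomial.C ⟨u, hu'⟩ * Polynomial.X + Polynomial.C ⟨v, hv'⟩,
      ?_, ?_⟩
    · nontriviality S
      monicity!
    · simpa [Polynomial.eval₂_add] using h
  exact isIntegral_trans (R := R) y this

namespace JkSetup

variable {k : Type*} [Field k] {a x : k} {q : kˣ} {A : Type*} [Ring A] [Algebra k A]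

lemma phi_range' (J : JkSetup k q a x A) {n : ℕ}
    (hq : IsPrimitiveRoot (q : k) n) (g) : (∃ c, J.phi c = g) ↔
    jkSL (q : k) g = g ∧ jkMu q g = g ∧
      ∀ m : ℕ, jkN (q : k) a x n ^ m ∣ g.coeff (-((n * m : ℕ) : ℤ)) := by
  rw [phi_range]
  refine and_congr_right fun _ => and_congr_right fun h2 => ⟨fun h m => ?_, fun h i => ?_⟩
  · have := h (-((n * m : ℕ) : ℤ))
    rwa [jkTau_neg, jkN_mul _ _ _ _ hq.pow_eq_one] at this
  · by_cases hi : (n : ℤ) ∣ i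
    · rcases jk_int_cases hi with ⟨m, rfl⟩ | ⟨m, rfl⟩
      · exact one_dvd _
      · rw [jkTau_neg, jkN_mul _ _ _ _ hq.pow_eq_one]; exact h m
    · rw [jk_mu_supp hq g h2 i hi]; exact dvd_zero _

lemma center_domain (J : JkSetup k q a x A) : IsDomain (Subalgebra.center k A) := J.phi_inj.isDomain J.phi

lemma psi_aux (J : JkSetup k q a x A) {n : ℕ}
    (hq : IsPrimitiveRoot (q : k) n) {F : Type*} [Field F] (ι : MvPolynomial (Fin 2) k →+* F) (ν : Fˣ)
    (hν : (ν : F) ^ n = ι (jkN (q : k) a x n)) (c) :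
    jkScale ι ν (J.phi c) ∈ (jkScale ι 1).range := by
  obtain ⟨h1, h2, h3⟩ := (J.phi_range' hq (J.phi c)).1 ⟨c, rfl⟩
  rw [jk_laurent_sum (J.phi c), map_sum]
  refine sum_mem fun i _ => ?_
  suffices h : ∃ d, ι d = ι ((J.phi c).coeff i) * ((ν ^ i : Fˣ) : F) by
    obtain ⟨d, hd⟩ := h
    exact ⟨C d * T i, by rw [jkScale_C_mul_T, jkScale_C_mul_T, hd]; simp⟩
  by_cases hi : (n : ℤ) ∣ i
  · rcases jk_int_cases hi with ⟨m, rfl⟩ | ⟨m, rfl⟩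
    · refine ⟨(J.phi c).coeff ((n * m : ℕ) : ℤ) * jkN (q : k) a x n ^ m, ?_⟩
      rw [map_mul, map_pow, ← hν, zpow_natCast, Units.val_pow_eq_pow_val, pow_mul]
    · obtain ⟨d, hd⟩ := h3 m
      refine ⟨d, ?_⟩
      rw [hd, map_mul, map_pow, ← hν, zpow_neg, zpow_natCast, ← pow_mul,
        ← Units.val_pow_eq_pow_val, mul_comm, ← mul_assoc, Units.inv_mul, one_mul]
  · exact ⟨0, by rw [jk_mu_supp hq _ h2 i hi]; simp⟩

lemma center_normal_aux (J : JkSetup k q a x A) {n : ℕ}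
    (hq : IsPrimitiveRoot (q : k) n) {F : Type*} [Field F]
    (ι : MvPolynomial (Fin 2) k →+* F) (hι : Function.Injective ι) (ν : Fˣ)
    (hν : (ν : F) ^ n = ι (jkN (q : k) a x n)) : IsIntegrallyClosed (Subalgebra.center k A) := by
  have hdom := J.center_domain
  have hL : IsIntegrallyClosed (LaurentPolynomial (MvPolynomial (Fin 2) k)) := jk_laurent_closed
  have hj := jkScale_injective ι hι 1
  have hM : IsIntegrallyClosed (jkScale ι 1).range :=
    IsIntegrallyClosed.of_equiv (RingEquiv.ofBijective (jkScale ι 1).rangeRestrict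
      ⟨fun _ _ h => hj (congrArg Subtype.val h), (jkScale ι 1).rangeRestrict_surjective⟩)
  let Ψ : Subalgebra.center k A →+* (jkScale ι 1).range :=
    ((jkScale ι ν).comp J.phi).codRestrict _ (J.psi_aux hq ι ν hν)
  have hΨ : Function.Injective Ψ := by
    intro c d h
    exact J.phi_inj (jkScale_injective ι hι ν (congrArg Subtype.val h))
  refine jk_closed_of_two J.phi J.phi_inj Ψ hΨ ?_
  rintro a' b hb ⟨g, hg⟩ ⟨⟨_, ⟨g', rfl⟩⟩, hg'⟩
  have hφb : J.phi b ≠ 0 := (map_ne_zero_iff _ J.phi_inj).2 hb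
  obtain ⟨a1, a2, -⟩ := (J.phi_range' hq _).1 ⟨a', rfl⟩
  obtain ⟨b1, b2, -⟩ := (J.phi_range' hq _).1 ⟨b, rfl⟩
  have hg1 : jkScale ι ν g = jkScale ι 1 g' := by
    have h1 : jkScale ι ν (J.phi a') = jkScale ι ν (J.phi b) * jkScale ι 1 g' :=
      congrArg Subtype.val hg'
    rw [hg, map_mul] at h1
    exact mul_left_cancel₀
      ((map_ne_zero_iff _ (jkScale_injective ι hι ν)).2 hφb) h1
  have hc : ∃ c, J.phi c = g := by
    refine (J.phi_range' hq g).2 ⟨?_, ?_, fun m => ⟨g'.coeff (-((n * m : ℕ) : ℤ)), ?_⟩⟩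
    · rw [hg, map_mul, b1] at a1
      exact mul_left_cancel₀ hφb a1
    · rw [hg, map_mul, b2] at a2
      exact mul_left_cancel₀ hφb a2
    · have h2 := congrArg (fun p => p.coeff (-((n * m : ℕ) : ℤ))) hg1
      simp only [jkScale_coeff] at h2
      rw [one_zpow, Units.val_one, mul_one] at h2
      apply hι
      rw [map_mul, ← h2, map_pow, ← hν, zpow_neg, zpow_natCast, ← pow_mul,
        ← Units.val_pow_eq_pow_val, mul_left_comm, Units.mul_inv, mul_one]
  obtain ⟨c, rfl⟩ := hc
  exact ⟨c, J.phi_inj (by rw [hg, map_mul])⟩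

lemma center_normal (J : JkSetup k q a x A) {n : ℕ}
    (hq : IsPrimitiveRoot (q : k) n) (hn : 0 < n) :
    IsIntegrallyClosed (Subalgebra.center k A) := by
  let F := AlgebraicClosure (FractionRing (MvPolynomial (Fin 2) k))
  let ι : MvPolynomial (Fin 2) k →+* F :=
    (algebraMap (FractionRing (MvPolynomial (Fin 2) k)) F).comp
      (algebraMap _ (FractionRing (MvPolynomial (Fin 2) k)))
  have hι : Function.Injective ι :=
    (algebraMap (FractionRing (MvPolynomial (Fin 2) k)) F).injective.comp
      (IsFractionRing.injective _ _)
  obtain ⟨ν0, hν0⟩ := IsAlgClosed.exists_pow_nat_eq (ι (jkN (q : k) a x n)) hn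
  have hN : ι (jkN (q : k) a x n) ≠ 0 :=
    (map_ne_zero_iff ι hι).2 (jkN_ne_zero _ _ _ q.ne_zero n)
  have hν0' : ν0 ≠ 0 := by
    rintro rfl
    rw [zero_pow hn.ne'] at hν0
    exact hN hν0.symm
  exact J.center_normal_aux hq ι hι (Units.mk0 ν0 hν0') hν0

/-- The element `T^n + N T^{-n}`. -/
noncomputable def U (q a x : k) (n : ℕ) : LaurentPolynomial (MvPolynomial (Fin 2) k) :=
  T (n : ℤ) + C (jkN q a x n) * T (-(n : ℤ))

lemma U_pow_coeff (q a x : k) (n : ℕ) (hn : 0 < n) (j : ℕ) (i : ℤ) (h : (n : ℤ) * j ≤ i) :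
    (U q a x n ^ j).coeff i = if i = n * j then 1 else 0 := by
  induction j generalizing i with
  | zero =>
    rw [pow_zero, ← T_zero, T]
    simp only [AddMonoidAlgebra.coeff_single, Finsupp.single_apply]
    simp [eq_comm]
  | succ j ih =>
    push_cast at h
    rw [mul_add, mul_one] at h
    rw [pow_succ', U, add_mul, ← U, mul_assoc, AddMonoidAlgebra.coeff_add, Finsupp.add_apply,
      jk_coeff_C_mul, jk_coeff_T_mul, jk_coeff_T_mul, ih _ (by omega), ih _ (by omega),
      if_neg (c := i - -(n : ℤ) = n * j) (by omega), mul_zero, add_zero]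
    congr 1
    push_cast
    rw [mul_add, mul_one]
    simp only [eq_iff_iff]
    omega

end JkSetup

lemma jkSL_U {k : Type*} [Field k] {q : kˣ} (a x : k) {n : ℕ} (hq : IsPrimitiveRoot (q : k) n) :
    jkSL (q : k) (JkSetup.U (q : k) a x n) = JkSetup.U (q : k) a x n := by
  rw [JkSetup.U, map_add, map_mul, jkSL_T, jkSL_T, jkSL_C, jkN_inv _ _ _ q.ne_zero _ hq.pow_eq_one]

lemma jkMu_U {k : Type*} [Field k] {q : kˣ} (a x : k) {n : ℕ} (hq : IsPrimitiveRoot (q : k) n) :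
    jkMu q (JkSetup.U (q : k) a x n) = JkSetup.U (q : k) a x n := by
  rw [JkSetup.U, map_add, map_mul, jkMu_T, jkMu_T, jkMu_C, zpow_neg, zpow_natCast, hq.pow_eq_one]
  simp

lemma jk_coeff_C {R : Type*} [CommRing R] (d : R) (i : ℤ) :
    (C d : LaurentPolynomial R).coeff i = if i = 0 then d else 0 := by
  rw [← single_eq_C]
  simp only [AddMonoidAlgebra.coeff_single, Finsupp.single_apply]
  simp [eq_comm]

lemma jk_coeff_T {R : Type*} [CommRing R] (j : ℤ) (i : ℤ) :
    (T j : LaurentPolynomial R).coeff i = if i = j then 1 else 0 := by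
  rw [T]
  simp only [AddMonoidAlgebra.coeff_single, Finsupp.single_apply]
  simp [eq_comm]

namespace JkSetup
variable {k : Type*} [Field k] {a x : k} {q : kˣ} {A : Type*} [Ring A] [Algebra k A]

lemma exists_U (J : JkSetup k q a x A) {n : ℕ} (hn : 0 < n)
    (hq : IsPrimitiveRoot (q : k) n) : ∃ c, J.phi c = U (q : k) a x n := by
  refine (J.phi_range' hq _).2 ⟨jkSL_U a x hq, jkMu_U a x hq, fun m => ?_⟩
  rw [U, AddMonoidAlgebra.coeff_add, Finsupp.add_apply, jk_coeff_C_mul, jk_coeff_T, jk_coeff_T]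
  rcases m with _ | _ | m
  · simp
  · rw [if_neg (by push_cast; omega)]
    simp
  · rw [if_neg (by push_cast; nlinarith), if_neg (by push_cast; nlinarith)]
    simp

lemma exists_X (J : JkSetup k q a x A) {n : ℕ} (hn : 0 < n)
    (hq : IsPrimitiveRoot (q : k) n) (i : Fin 2) :
    ∃ c, J.phi c = C (MvPolynomial.X i ^ n) := by
  refine (J.phi_range' hq _).2 ⟨?_, jkMu_C _ _, fun m => ?_⟩
  · rw [jkSL_C]
    congr 1
    fin_cases i
    · simp only [Fin.zero_eta]
      rw [map_pow, jkS_X0, mul_pow, ← map_pow, hq.pow_eq_one, map_one, one_mul]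
    · simp only [Fin.mk_one]
      rw [map_pow, jkS_X1, mul_pow, ← map_pow, ← pow_mul, mul_comm 2, pow_mul, hq.pow_eq_one,
        one_pow, map_one, one_mul]
  · rw [jk_coeff_C]
    cases m with
    | zero => simp
    | succ m =>
      rw [if_neg (by push_cast; nlinarith)]
      exact dvd_zero _

lemma phi_algebraMap (J : JkSetup k q a x A) (r : k) :
    J.phi (algebraMap k _ r) = C (MvPolynomial.C r) := by
  change J.rho (algebraMap k A r) 1 = _
  rw [← J.dl.commutes, rhod, mul_one]
  rfl

lemma exists_f (J : JkSetup k q a x A) {n : ℕ} (hn : 0 < n) (hq : IsPrimitiveRoot (q : k) n) :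
    ∃ f : Polynomial (MvPolynomial (Fin 2) k) →+* Subalgebra.center k A,
      J.phi.comp f = Polynomial.eval₂RingHom
        ((C : _ →+* LaurentPolynomial (MvPolynomial (Fin 2) k)).comp
          (MvPolynomial.expand n).toRingHom) (U (q : k) a x n) := by
  obtain ⟨u, hu⟩ := J.exists_U hn hq
  choose y hy using J.exists_X hn hq
  refine ⟨Polynomial.eval₂RingHom (MvPolynomial.eval₂Hom (algebraMap k _) y) u, ?_⟩
  apply Polynomial.ringHom_ext'
  · apply MvPolynomial.ringHom_ext
    · intro r
      simp [phi_algebraMap]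
    · intro i
      simp [hy]
  · simp [hu]

lemma F_inj {n : ℕ} (hn : 0 < n) (q : k) : Function.Injective (Polynomial.eval₂RingHom
        ((C : _ →+* LaurentPolynomial (MvPolynomial (Fin 2) k)).comp
          (MvPolynomial.expand n).toRingHom) (U (q : k) a x n)) := by
  rw [injective_iff_map_eq_zero]
  intro p hp
  by_contra h0
  rw [Polynomial.coe_eval₂RingHom, Polynomial.eval₂_eq_sum_range] at hp
  have h1 := congrArg (fun g => g.coeff ((n : ℤ) * p.natDegree)) hp
  simp only [AddMonoidAlgebra.coeff_sum, Finsupp.finsetSum_apply, RingHom.comp_apply,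
    jk_coeff_C_mul] at h1
  rw [Finset.sum_range_succ, Finset.sum_eq_zero, U_pow_coeff _ _ _ _ hn _ _ le_rfl] at h1
  · have h2 : MvPolynomial.expand n p.leadingCoeff = 0 := by simpa using h1
    rw [map_eq_zero_iff _ (MvPolynomial.expand_injective hn)] at h2
    exact h0 (Polynomial.leadingCoeff_eq_zero.1 h2)
  · intro j hj
    have hj' : (n : ℤ) * j < n * p.natDegree := by
      have := Finset.mem_range.1 hj
      exact_mod_cast Nat.mul_lt_mul_of_pos_left this hn
    rw [U_pow_coeff _ _ _ _ hn _ _ hj'.le, if_neg hj'.ne', mul_zero]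

lemma int_C {n : ℕ} (hn : 0 < n) (q : k) (d : MvPolynomial (Fin 2) k) :
    (Polynomial.eval₂RingHom
        ((C : _ →+* LaurentPolynomial (MvPolynomial (Fin 2) k)).comp
          (MvPolynomial.expand n).toRingHom) (U (q : k) a x n)).IsIntegralElem (C d) := by
  induction d using MvPolynomial.induction_on with
  | C r =>
    have := RingHom.isIntegralElem_map (Polynomial.eval₂RingHom
        ((C : _ →+* LaurentPolynomial (MvPolynomial (Fin 2) k)).comp
          (MvPolynomial.expand n).toRingHom) (U (q : k) a x n))
          (x := Polynomial.C (MvPolynomial.C r))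
    simpa using this
  | add d e hd he => rw [map_add]; exact RingHom.IsIntegralElem.add _ hd he
  | mul_X d i hd =>
    rw [map_mul]
    refine RingHom.IsIntegralElem.mul _ hd ?_
    apply jk_int_of_pow _ _ n hn
    have := RingHom.isIntegralElem_map (Polynomial.eval₂RingHom
        ((C : _ →+* LaurentPolynomial (MvPolynomial (Fin 2) k)).comp
          (MvPolynomial.expand n).toRingHom) (U (q : k) a x n))
          (x := Polynomial.C (MvPolynomial.X i))
    simpa using this

lemma int_U {n : ℕ} (q : k) :
    (Polynomial.eval₂RingHom
        ((C : _ →+* LaurentPolynomial (MvPolynomial (Fin 2) k)).comp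
          (MvPolynomial.expand n).toRingHom) (U (q : k) a x n)).IsIntegralElem (U q a x n) := by
  have := RingHom.isIntegralElem_map (Polynomial.eval₂RingHom
        ((C : _ →+* LaurentPolynomial (MvPolynomial (Fin 2) k)).comp
          (MvPolynomial.expand n).toRingHom) (U (q : k) a x n))
          (x := Polynomial.X)
  simpa using this

lemma int_T {n : ℕ} (hn : 0 < n) (q : k) :
    (Polynomial.eval₂RingHom
        ((C : _ →+* LaurentPolynomial (MvPolynomial (Fin 2) k)).comp
          (MvPolynomial.expand n).toRingHom) (U (q : k) a x n)).IsIntegralElem (T (n : ℤ)) := by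
  refine jk_int_quad _ _ _ _ (int_U q) (int_C hn q (jkN q a x n)) ?_
  have h : (T (n : ℤ) * T (-(n : ℤ)) : LaurentPolynomial (MvPolynomial (Fin 2) k)) = 1 := by
    rw [← T_add, add_neg_cancel, T_zero]
  rw [U]
  linear_combination (-C (jkN q a x n)) * h

lemma int_NT {n : ℕ} (hn : 0 < n) (q : k) :
    (Polynomial.eval₂RingHom
        ((C : _ →+* LaurentPolynomial (MvPolynomial (Fin 2) k)).comp
          (MvPolynomial.expand n).toRingHom) (U (q : k) a x n)).IsIntegralElem
            (C (jkN q a x n) * T (-(n : ℤ))) := by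
  have := RingHom.IsIntegralElem.sub _ (int_U (a := a) (x := x) q) (int_T hn q)
  have h2 : U q a x n - T (n : ℤ) = C (jkN q a x n) * T (-(n : ℤ)) := by
    rw [U, add_sub_cancel_left]
  rwa [h2] at this

lemma center_dim (J : JkSetup k q a x A) {n : ℕ} (hn : 0 < n) (hq : IsPrimitiveRoot (q : k) n) :
    ringKrullDim (Subalgebra.center k A) = 3 := by
  obtain ⟨f, hf⟩ := J.exists_f hn hq
  have hinj : Function.Injective f := by
    have := F_inj (a := a) (x := x) hn (q : k)
    rw [← hf] at this
    exact Function.Injective.of_comp (f := J.phi) this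
  have h_int : f.IsIntegral := by
    intro c
    have key : (J.phi.comp f).IsIntegralElem (J.phi c) := by
      rw [hf]
      obtain ⟨h1, h2, h3⟩ := (J.phi_range' hq (J.phi c)).1 ⟨c, rfl⟩
      rw [jk_laurent_sum (J.phi c)]
      refine jk_int_sum _ _ _ fun i _ => ?_
      by_cases hi : (n : ℤ) ∣ i
      · rcases jk_int_cases hi with ⟨m, rfl⟩ | ⟨m, rfl⟩
        · refine RingHom.IsIntegralElem.mul _ (int_C hn _ _) ?_
          have := jk_int_pow _ _ (int_T (a := a) (x := x) hn (q : k)) m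
          rwa [T_pow, mul_comm, ← Nat.cast_mul] at this
        · obtain ⟨d, hd⟩ := h3 m
          rw [hd, mul_comm (_ ^ m) d, map_mul, mul_assoc]
          refine RingHom.IsIntegralElem.mul _ (int_C hn _ _) ?_
          have := jk_int_pow _ _ (int_NT (a := a) (x := x) hn (q : k)) m
          rwa [mul_pow, T_pow, mul_neg, mul_comm (m : ℤ), ← Nat.cast_mul, ← map_pow] at this
      · rw [jk_mu_supp hq _ h2 i hi, map_zero, zero_mul]
        exact RingHom.isIntegralElem_zero _
    obtain ⟨p, hp, hpe⟩ := key
    refine ⟨p, hp, J.phi_inj ?_⟩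
    rw [map_zero, Polynomial.hom_eval₂, hpe]
  rw [jk_krullDim_integral f hinj h_int, Polynomial.ringKrullDim_of_isNoetherianRing,
    MvPolynomial.ringKrullDim_of_isNoetherianRing, ringKrullDim_eq_zero_of_field]
  simp
  norm_num

end JkSetup

lemma jk_dl_exists {k A : Type*} [Field k] [Ring A] [Algebra k A] (u v : A) (h : u * v = v * u) :
    ∃ δ : MvPolynomial (Fin 2) k →ₐ[k] A, δ (MvPolynomial.X 0) = u ∧ δ (MvPolynomial.X 1) = v := by
  let : CommRing (Algebra.adjoin k {u, v}) := Algebra.adjoinCommRingOfComm k (by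
    rintro a (rfl | rfl) b (rfl | rfl) <;> simp [h])
  refine ⟨(Algebra.adjoin k {u, v}).val.comp (MvPolynomial.aeval
    ![⟨u, Algebra.subset_adjoin (by simp)⟩, ⟨v, Algebra.subset_adjoin (by simp)⟩]), ?_, ?_⟩
  · simp
  · simp

lemma jk_twist {k A : Type*} [Field k] [Ring A] [Algebra k A]
    (δ : MvPolynomial (Fin 2) k →ₐ[k] A) (e : A) (u : k)
    (h0 : e * δ (MvPolynomial.X 0) = u • (δ (MvPolynomial.X 0) * e))
    (h1 : e * δ (MvPolynomial.X 1) = u ^ 2 • (δ (MvPolynomial.X 1) * e))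
    (d : MvPolynomial (Fin 2) k) : e * δ d = δ (jkS u d) * e := by
  induction d using MvPolynomial.induction_on with
  | C r =>
    rw [jkS_C, ← MvPolynomial.algebraMap_eq, AlgHom.commutes]
    exact (Algebra.commutes r e).symm
  | add d e hd he => rw [map_add, map_add, map_add, mul_add, add_mul, hd, he]
  | mul_X d i hd =>
    rw [map_mul, map_mul, map_mul, ← mul_assoc, hd, mul_assoc, mul_assoc]
    congr 1
    fin_cases i
    · simp only [Fin.zero_eta]
      rw [h0, jkS_X0, ← MvPolynomial.smul_eq_C_mul, map_smul, smul_mul_assoc]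
    · simp only [Fin.mk_one]
      rw [h1, jkS_X1, ← MvPolynomial.smul_eq_C_mul, map_smul, smul_mul_assoc]

lemma jk_C_smul {k : Type*} [Field k] (r : k) (m : LaurentPolynomial (MvPolynomial (Fin 2) k)) :
    r • m = C (MvPolynomial.C r) * m := by
  apply LaurentPolynomial.ext
  intro i
  rw [jk_coeff_C_mul, AddMonoidAlgebra.coeff_smul, Finsupp.smul_apply, MvPolynomial.smul_eq_C_mul]

lemma jk_nonempty {k A : Type*} [Field k] [Ring A] [Algebra k A] (q a x : k) (hq : q ≠ 0)
    (ha : a * (q ^ 2 - q) = x) (e0 e1 e2 : A)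
    (r01 : e0 * e1 = q • (e1 * e0)) (r20 : e2 * e0 = q • (e0 * e2))
    (r21 : e2 * e1 = q ^ 2 • (e1 * e2) + x • e0 + (x * (1 - q ^ 2)) • (1 : A))
    (gen : Algebra.adjoin k {e0, e1, e2} = ⊤)
    (rho : A →ₐ[k] Module.End k (LaurentPolynomial (MvPolynomial (Fin 2) k)))
    (rho0 : ∀ m, rho e0 m = C (MvPolynomial.X 0) * m)
    (rho1 : ∀ m, rho e1 m = C (jkT a x) * T (-1) * jkSL q⁻¹ m)
    (rho2 : ∀ m, rho e2 m = T 1 * jkSL q m) : Nonempty (JkSetup k q a x A) := by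
  obtain ⟨δ, d0, d1⟩ := jk_dl_exists (k := k) e0 (e1 * e2 + a • e0 - x • (1 : A)) (by
    have h1 : e0 * (e1 * e2) = (e1 * e2) * e0 := by
      rw [← mul_assoc, r01, mul_assoc e1, r20]
      simp [mul_assoc]
    simp [mul_sub, sub_mul, mul_add, add_mul, h1])
  have z2 : e2 * δ (MvPolynomial.X 1) = q ^ 2 • (δ (MvPolynomial.X 1) * e2) := by
    rw [d1, mul_sub, mul_add, ← mul_assoc, r21, mul_smul_comm, r20]
    simp only [add_mul, sub_mul, smul_mul_assoc, one_mul, mul_smul_comm, mul_one, mul_assoc]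
    subst ha
    module
  have z1 : δ (MvPolynomial.X 1) * e1 = q ^ 2 • (e1 * δ (MvPolynomial.X 1)) := by
    rw [d1, sub_mul, add_mul, mul_assoc, r21, smul_mul_assoc, r01]
    simp only [mul_add, mul_sub, smul_mul_assoc, one_mul, mul_smul_comm, mul_one, mul_assoc]
    subst ha
    module
  have dt : ∀ u v w : k, δ (MvPolynomial.C u * MvPolynomial.X 1 -
      MvPolynomial.C v * MvPolynomial.X 0 + MvPolynomial.C w) =
      u • (e1 * e2 + a • e0 - x • (1 : A)) - v • e0 + w • (1 : A) := by
    intro u v w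
    rw [← MvPolynomial.smul_eq_C_mul, ← MvPolynomial.smul_eq_C_mul, map_add, map_sub, map_smul,
      map_smul, d0, d1, ← MvPolynomial.algebraMap_eq, AlgHom.commutes, Algebra.algebraMap_eq_smul_one]
  refine ⟨⟨e0, e1, e2, δ, rho, d0, jk_twist δ e1 q⁻¹ ?_ ?_, jk_twist δ e2 q ?_ z2, ?_, ?_, gen,
    rho1, rho2, ?_⟩⟩
  · rw [d0, r01, smul_smul, inv_mul_cancel₀ hq, one_smul]
  · rw [z1, smul_smul, inv_pow, inv_mul_cancel₀ (pow_ne_zero 2 hq), one_smul]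
  · rw [d0, r20]
  · have := dt 1 a x
    rw [map_one, one_mul] at this
    rw [jkT, this]
    module
  · have := dt (q ^ 2) (a * q) x
    rw [r21, jkT, map_add, map_sub, map_mul, jkS_X1, jkS_X0, jkS_C, jkS_C, ← mul_assoc,
      ← map_mul, this]
    subst ha
    module
  · intro d
    induction d using MvPolynomial.induction_on with
    | C r =>
      intro m
      rw [← MvPolynomial.algebraMap_eq, AlgHom.commutes, AlgHom.commutes,
        Module.algebraMap_end_apply, MvPolynomial.algebraMap_eq, jk_C_smul]
    | add d e hd he =>
      intro m
      rw [map_add, map_add, LinearMap.add_apply, hd, he, map_add, add_mul]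
    | mul_X d i hd =>
      intro m
      rw [map_mul, map_mul, Module.End.mul_apply, hd, map_mul, mul_assoc]
      congr 1
      fin_cases i
      · simp only [Fin.zero_eta]
        rw [d0, rho0]
      · simp only [Fin.mk_one]
        rw [d1, map_sub, map_add, LinearMap.sub_apply, LinearMap.add_apply, map_mul,
          Module.End.mul_apply, map_smul, map_smul, LinearMap.smul_apply, LinearMap.smul_apply,
          map_one, Module.End.one_apply, rho0, rho2, rho1, map_mul, jkSL_T, jkSL_jkSL,
          inv_mul_cancel₀ hq, jkSL_one, jk_C_smul, jk_C_smul]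
        have h : (T (-1) * T 1 : LaurentPolynomial (MvPolynomial (Fin 2) k)) = 1 := by
          rw [← T_add]; simp
        rw [jkT, map_add, map_sub, map_mul]
        linear_combination ((C (MvPolynomial.X 1) - C (MvPolynomial.C a) * C (MvPolynomial.X 0) +
          C (MvPolynomial.C x)) * m) * h

/-- The operators through which the generators act. -/
noncomputable def jkE {k : Type*} [Field k] (q a x : k) :
    Fin 3 → Module.End k (LaurentPolynomial (MvPolynomial (Fin 2) k)) :=
  ![LinearMap.mulLeft k (C (MvPolynomial.X 0)),
    (LinearMap.mulLeft k (C (jkT a x) * T (-1))).comp (jkSL q⁻¹).toLinearMap,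
    (LinearMap.mulLeft k (T 1)).comp (jkSL q).toLinearMap]

lemma jkE0 {k : Type*} [Field k] (q a x : k) (m) : jkE q a x 0 m = C (MvPolynomial.X 0) * m := rfl
lemma jkE1 {k : Type*} [Field k] (q a x : k) (m) :
    jkE q a x 1 m = C (jkT a x) * T (-1) * jkSL q⁻¹ m := rfl
lemma jkE2 {k : Type*} [Field k] (q a x : k) (m) : jkE q a x 2 m = T 1 * jkSL q m := rfl

lemma jkE_rel {k : Type*} [Field k] (ζ : k) (r : ℤ) (a x : k) (hq : ζ ^ r ≠ 0)
    (ha : a * ((ζ ^ r) ^ 2 - ζ ^ r) = x) ⦃u v : FreeAlgebra k (Fin 3)⦄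
    (h : JacksonRel k ζ r x u v) :
    FreeAlgebra.lift k (jkE (ζ ^ r) a x) u = FreeAlgebra.lift k (jkE (ζ ^ r) a x) v := by
  have h2 : ζ ^ (2 * r) = (ζ ^ r) ^ 2 := by rw [mul_comm, zpow_mul]; norm_cast
  have hT : (T (-1) * T 1 : LaurentPolynomial (MvPolynomial (Fin 2) k)) = 1 := by
    rw [← T_add]; simp
  cases h with
  | r01 =>
    refine LinearMap.ext fun m => ?_
    simp only [map_mul, map_smul, FreeAlgebra.lift_ι_apply, Module.End.mul_apply,
      LinearMap.smul_apply, jkE0, jkE1]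
    rw [jkSL_C, jkS_X0, jk_C_smul, map_mul]
    have : (C (MvPolynomial.C (ζ ^ r)) * C (MvPolynomial.C (ζ ^ r)⁻¹) :
        LaurentPolynomial (MvPolynomial (Fin 2) k)) = 1 := by
      rw [← map_mul, ← map_mul, mul_inv_cancel₀ hq, map_one, map_one]
    linear_combination -(C (MvPolynomial.X 0) * (C (jkT a x) * T (-1) * (jkSL (ζ ^ r)⁻¹) m)) * this
  | r20 =>
    refine LinearMap.ext fun m => ?_
    simp only [map_mul, map_smul, FreeAlgebra.lift_ι_apply, Module.End.mul_apply,
      LinearMap.smul_apply, jkE0, jkE2]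
    rw [jkSL_C, jkS_X0, jk_C_smul, map_mul]
    ring
  | r21 =>
    rw [h2]
    generalize ζ ^ r = q at *
    refine LinearMap.ext fun m => ?_
    simp only [map_mul, map_smul, map_add, map_one, FreeAlgebra.lift_ι_apply, Module.End.mul_apply,
      LinearMap.smul_apply, LinearMap.add_apply, Module.End.one_apply, jkE0, jkE1, jkE2]
    rw [jkSL_jkSL, jkSL_jkSL, mul_inv_cancel₀ hq, inv_mul_cancel₀ hq, jkSL_one, jkSL_T, jkSL_T,
      jkSL_C, jk_C_smul, jk_C_smul, jk_C_smul]
    have h3 : C (jkS q (jkT a x)) = C (MvPolynomial.C (q ^ 2)) * C (jkT a x) +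
        C (MvPolynomial.C x) * C (MvPolynomial.X 0) + C (MvPolynomial.C (x * (1 - q ^ 2))) := by
      simp only [← map_mul, ← map_add]
      congr 1
      simp only [jkT, map_add, map_sub, map_mul, jkS_X1, jkS_X0, jkS_C, ← ha, map_one, map_pow]
      ring
    rw [h3]
    linear_combination (C (MvPolynomial.C x) * C (MvPolynomial.X 0) * m +
      C (MvPolynomial.C (x * (1 - q ^ 2))) * m) * hT

lemma jk_exists_setup {k : Type*} [Field k] (ζ : k) (r : ℤ) (a x : k) (hq : ζ ^ r ≠ 0)
    (ha : a * ((ζ ^ r) ^ 2 - ζ ^ r) = x) :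
    Nonempty (JkSetup k (ζ ^ r) a x (Jackson k ζ r x)) := by
  have h2 : ζ ^ (2 * r) = (ζ ^ r) ^ 2 := by rw [mul_comm, zpow_mul]; norm_cast
  have hρ : ∀ i, RingQuot.liftAlgHom k ⟨FreeAlgebra.lift k (jkE (ζ ^ r) a x),
      jkE_rel ζ r a x hq ha⟩ (JacksonGen k ζ r x i) = jkE (ζ ^ r) a x i := by
    intro i
    rw [JacksonGen, RingQuot.liftAlgHom_mkAlgHom_apply, FreeAlgebra.lift_ι_apply]
  refine jk_nonempty (ζ ^ r) a x hq ha (JacksonGen k ζ r x 0) (JacksonGen k ζ r x 1)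
    (JacksonGen k ζ r x 2) ?_ ?_ ?_ ?_ (RingQuot.liftAlgHom k
      ⟨FreeAlgebra.lift k (jkE (ζ ^ r) a x), jkE_rel ζ r a x hq ha⟩) ?_ ?_ ?_
  · have := RingQuot.mkAlgHom_rel k (JacksonRel.r01 (k := k) (ζ := ζ) (r := r) (x := x))
    simpa only [JacksonGen, map_mul, map_smul] using this
  · have := RingQuot.mkAlgHom_rel k (JacksonRel.r20 (k := k) (ζ := ζ) (r := r) (x := x))
    simpa only [JacksonGen, map_mul, map_smul] using this
  · have := RingQuot.mkAlgHom_rel k (JacksonRel.r21 (k := k) (ζ := ζ) (r := r) (x := x))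
    rw [← h2]
    simpa only [JacksonGen, map_mul, map_smul, map_add, map_one] using this
  · have h3 : ({JacksonGen k ζ r x 0, JacksonGen k ζ r x 1, JacksonGen k ζ r x 2} :
        Set (Jackson k ζ r x)) = RingQuot.mkAlgHom k (JacksonRel k ζ r x) ''
          (Set.range (FreeAlgebra.ι k)) := by
      ext y
      constructor
      · rintro (rfl | rfl | rfl)
        · exact ⟨_, ⟨0, rfl⟩, rfl⟩
        · exact ⟨_, ⟨1, rfl⟩, rfl⟩
        · exact ⟨_, ⟨2, rfl⟩, rfl⟩
      · rintro ⟨_, ⟨i, rfl⟩, rfl⟩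
        fin_cases i
        · exact Or.inl rfl
        · exact Or.inr (Or.inl rfl)
        · exact Or.inr (Or.inr rfl)
    rw [h3, ← AlgHom.map_adjoin, FreeAlgebra.adjoin_range_ι, Algebra.map_top, AlgHom.range_eq_top]
    exact RingQuot.mkAlgHom_surjective k _
  · intro m; rw [hρ, jkE0]
  · intro m; rw [hρ, jkE1]
  · intro m; rw [hρ, jkE2]

end JacksonHelpers

/-- Let `k` be a field, `n ≥ 2`, `ζ ∈ k` a primitive `n`-th root
of unity, `r` an integer such that `ζ^r` is again a primitive `n`-th root of unity,
and `x ∈ k`.  Then the centre `Z(𝒥_x(r))` of the Jackson algebra is an integrally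
closed (normal) commutative domain whose Krull dimension equals `3`. -/
theorem jackson_centre_normal_dim_three (k : Type*) [Field k]
    (n : ℕ) (hn : 2 ≤ n) (ζ : k) (hζ : IsPrimitiveRoot ζ n)
    (r : ℤ) (hr : IsPrimitiveRoot (ζ ^ r) n) (x : k) :
    IsDomain (Subalgebra.center k (Jackson k ζ r x)) ∧
    IsIntegrallyClosed (Subalgebra.center k (Jackson k ζ r x)) ∧
    ringKrullDim (Subalgebra.center k (Jackson k ζ r x)) = 3 := by
  have hn0 : 0 < n := by omega
  have hq : ζ ^ r ≠ 0 := hr.ne_zero hn0.ne'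
  have hq1 : ζ ^ r ≠ 1 := hr.ne_one (by omega)
  have hne : (ζ ^ r) ^ 2 - ζ ^ r ≠ 0 := by
    have : (ζ ^ r) ^ 2 - ζ ^ r = ζ ^ r * (ζ ^ r - 1) := by ring
    rw [this]
    exact mul_ne_zero hq (sub_ne_zero.2 hq1)
  obtain ⟨J⟩ := jk_exists_setup ζ r (x / ((ζ ^ r) ^ 2 - ζ ^ r)) x hq (div_mul_cancel₀ x hne)
  obtain ⟨q, hqq⟩ : ∃ q : kˣ, (q : k) = ζ ^ r := ⟨Units.mk0 _ hq, rfl⟩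
  rw [← hqq] at J hr
  exact ⟨J.center_domain, J.center_normal hr hn0, J.center_dim hn0 hr⟩
end

section
/- Let k be a field, n ≥ 2 an integer, ζ ∈ k a primitive n-th root of unity, and r an integer with ζ^r ≠ 1 and ζ^{2r} ≠ 1. Then the k-algebra homomorphisms φ : 𝒥₀(r) → k (the case x = 0) are exactly those determined by triples (φ(e₀), φ(e₁), φ(e₂)) = (a, b, c) satisfying ab = 0, ac = 0 and bc = 0, i.e. at most one of a, b, c is nonzero; every such triple extends (uniquely) to an algebra homomorphism. In particular the one-dimensional points lie on the union of the coordinate planes. -/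
/-- Let `k` be a field, `n ≥ 2`, `ζ ∈ k` a primitive `n`-th root
of unity, and `r` an integer with `ζ^r ≠ 1` and `ζ^{2r} ≠ 1`.  The `k`-algebra
homomorphisms `φ : 𝒥₀(r) → k` are exactly those determined by triples
`(φ e₀, φ e₁, φ e₂) = (a, b, c)` with `ab = 0`, `ac = 0` and `bc = 0` (i.e. at most
one of `a, b, c` is nonzero); every such triple extends uniquely to an algebra
homomorphism.  In particular the one-dimensional points lie on the union of the
coordinate planes. -/
theorem jackson_zero_one_dimensional_points (k : Type*) [Field k] (n : ℕ) (hn : 2 ≤ n)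
    (ζ : k) (hζ : IsPrimitiveRoot ζ n) (r : ℤ)
    (hr1 : ζ ^ r ≠ 1) (hr2 : ζ ^ (2 * r) ≠ 1) :
    (∀ φ : Jackson k ζ r 0 →ₐ[k] k,
      φ (JacksonGen k ζ r 0 0) * φ (JacksonGen k ζ r 0 1) = 0 ∧
      φ (JacksonGen k ζ r 0 0) * φ (JacksonGen k ζ r 0 2) = 0 ∧
      φ (JacksonGen k ζ r 0 1) * φ (JacksonGen k ζ r 0 2) = 0) ∧
    (∀ a b c : k, a * b = 0 → a * c = 0 → b * c = 0 →
      ∃! φ : Jackson k ζ r 0 →ₐ[k] k,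
        φ (JacksonGen k ζ r 0 0) = a ∧ φ (JacksonGen k ζ r 0 1) = b ∧
          φ (JacksonGen k ζ r 0 2) = c) := by
  constructor
  · intro φ
    have key : ∀ q u v : k, q ≠ 1 → u * v = q * (v * u) → u * v = 0 := by
      intro q u v hq h
      have h1 : (1 - q) * (u * v) = 0 := by
        linear_combination h
      rcases mul_eq_zero.mp h1 with h2 | h2
      · exact absurd (sub_eq_zero.mp h2).symm hq
      · exact h2
    have h01 := congrArg φ (RingQuot.mkAlgHom_rel k (JacksonRel.r01 (k := k) (ζ := ζ) (r := r) (x := 0)))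
    have h20 := congrArg φ (RingQuot.mkAlgHom_rel k (JacksonRel.r20 (k := k) (ζ := ζ) (r := r) (x := 0)))
    have h21 := congrArg φ (RingQuot.mkAlgHom_rel k (JacksonRel.r21 (k := k) (ζ := ζ) (r := r) (x := 0)))
    simp only [map_mul, map_smul, map_add, zero_smul, zero_mul, add_zero, smul_eq_mul]
      at h01 h20 h21
    refine ⟨key _ _ _ hr1 h01, ?_, ?_⟩
    · rw [mul_comm]
      exact key _ _ _ hr1 h20
    · rw [mul_comm]
      exact key _ _ _ hr2 h21
  · intro a b c hab hac hbc
    have hba : b * a = 0 := by rw [mul_comm, hab]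
    have hca : c * a = 0 := by rw [mul_comm, hac]
    have hcb : c * b = 0 := by rw [mul_comm, hbc]
    have hrel : ∀ ⦃u v : FreeAlgebra k (Fin 3)⦄, JacksonRel k ζ r 0 u v →
        FreeAlgebra.lift k ![a, b, c] u = FreeAlgebra.lift k ![a, b, c] v := by
      intro u v h
      cases h <;> simp [hab, hac, hbc, hba, hca, hcb]
    refine ⟨RingQuot.liftAlgHom k ⟨FreeAlgebra.lift k ![a, b, c], hrel⟩, ?_, ?_⟩
    · refine ⟨?_, ?_, ?_⟩ <;> simp [JacksonGen]
    · rintro ψ ⟨h0, h1, h2⟩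
      apply RingQuot.ringQuot_ext'
      apply FreeAlgebra.hom_ext
      funext i
      fin_cases i
      · simpa [JacksonGen] using h0
      · simpa [JacksonGen] using h1
      · simpa [JacksonGen] using h2
end
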